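/- arXiv:1903.11138 — 2 statements merged into one kernel-verified Lean document; each statement's English description precedes it below -/
import Mathlib

section
/- HyperLTL-SAT is undecidable: the set of (Gödel codes of) satisfiable HyperLTL formulas is not a computable (decidable) predicate on ℕ. -/
/-- A trace over atomic propositions (modeled as naturals). -/
abbrev Trace : Type := ℕ → Set ℕ

/-- HyperLTL formulas: atomic propositions `a` and trace variables `π` are naturals. -/
inductive HLTL : Type
  | tt    : HLTL
  | atom  : ℕ → ℕ → HLTL            -- `atom a π` is `a_π`
  | neg   : HLTL → HLTL
  | or    : HLTL → HLTL → HLTL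
  | next  : HLTL → HLTL
  | until_ : HLTL → HLTL → HLTL
  | ex    : ℕ → HLTL → HLTL          -- `∃ π. ψ`
  | all   : ℕ → HLTL → HLTL          -- `∀ π. ψ`

namespace HLTL

/-- Shift every trace in the range of an assignment by `i` steps. -/
def shift (A : ℕ → Trace) (i : ℕ) : ℕ → Trace := fun π n => A π (n + i)

/-- Semantics of HyperLTL: `sat T ψ A` is `A ⊨_T ψ`. -/
def sat (T : Set Trace) : HLTL → (ℕ → Trace) → Prop
  | .tt, _ => True
  | .atom a π, A => a ∈ A π 0
  | .neg φ, A => ¬ sat T φ A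
  | .or φ ψ, A => sat T φ A ∨ sat T ψ A
  | .next φ, A => sat T φ (shift A 1)
  | .until_ φ ψ, A => ∃ i, sat T ψ (shift A i) ∧ ∀ j < i, sat T φ (shift A j)
  | .ex π φ, A => ∃ t ∈ T, sat T φ (Function.update A π t)
  | .all π φ, A => ∀ t ∈ T, sat T φ (Function.update A π t)

/-- Quantifier-free formulas. -/
def quantFree : HLTL → Bool
  | .tt => true
  | .atom _ _ => true
  | .neg φ => quantFree φ
  | .or φ ψ => quantFree φ && quantFree ψ
  | .next φ => quantFree φ
  | .until_ φ ψ => quantFree φ && quantFree ψ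
  | .ex _ _ => false
  | .all _ _ => false

/-- All trace quantifiers occur in a prefix. -/
def prenex : HLTL → Bool
  | .ex _ φ => prenex φ
  | .all _ φ => prenex φ
  | φ => quantFree φ

/-- Free trace variables of a formula. -/
def free : HLTL → Finset ℕ
  | .tt => ∅
  | .atom _ π => {π}
  | .neg φ => free φ
  | .or φ ψ => free φ ∪ free ψ
  | .next φ => free φ
  | .until_ φ ψ => free φ ∪ free ψ
  | .ex π φ => (free φ).erase π
  | .all π φ => (free φ).erase π

/-- A HyperLTL formula (as in the grammar): a closed sentence with all
trace quantifiers in a prefix. -/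
def Sentence (ψ : HLTL) : Prop := prenex ψ = true ∧ free ψ = ∅

/-- `T` satisfies `ψ`: `T` is nonempty and `∅ ⊨_T ψ` (for closed `ψ` the
trace assignment is irrelevant, so we quantify over all assignments). -/
def SatBy (T : Set Trace) (ψ : HLTL) : Prop :=
  T.Nonempty ∧ ∀ A : ℕ → Trace, sat T ψ A

/-- HyperLTL satisfiability. -/
def Satisfiable (ψ : HLTL) : Prop := ∃ T : Set Trace, SatBy T ψ

/-- A computable injective Gödel encoding of HyperLTL formulas. -/
def encode : HLTL → ℕ
  | .tt => 0
  | .atom a π => 8 * Nat.pair a π + 1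
  | .neg φ => 8 * encode φ + 2
  | .or φ ψ => 8 * Nat.pair (encode φ) (encode ψ) + 3
  | .next φ => 8 * encode φ + 4
  | .until_ φ ψ => 8 * Nat.pair (encode φ) (encode ψ) + 5
  | .ex π φ => 8 * Nat.pair π (encode φ) + 6
  | .all π φ => 8 * Nat.pair π (encode φ) + 7

end HLTL

/-- The set of Gödel codes of satisfiable (closed, prenex) HyperLTL formulas. -/
def HyperLTLSatCode (n : ℕ) : Prop :=
  ∃ ψ : HLTL, HLTL.Sentence ψ ∧ HLTL.encode ψ = n ∧ HLTL.Satisfiable ψ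

/-- A predicate on ℕ is computably enumerable iff it is the domain of a
partial computable function. -/
def REpred (p : ℕ → Prop) : Prop :=
  ∃ f : ℕ →. ℕ, Partrec f ∧ ∀ n, p n ↔ (f n).Dom

namespace HLTL

/-! ### Encoding is injective -/

theorem encode_inj : ∀ φ ψ : HLTL, encode φ = encode ψ → φ = ψ := by
  intro φ
  induction φ with
  | tt => intro ψ h; cases ψ <;> simp only [encode] at h <;> first | rfl | omega
  | atom a p =>
    intro ψ h
    cases ψ <;> simp only [encode] at h <;> try omega
    rename_i b q
    have := Nat.pair_eq_pair.1 (show Nat.pair a p = Nat.pair b q by omega)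
    rw [this.1, this.2]
  | neg φ ih =>
    intro ψ h
    cases ψ <;> simp only [encode] at h <;> try omega
    rename_i b
    rw [ih b (by omega)]
  | next φ ih =>
    intro ψ h
    cases ψ <;> simp only [encode] at h <;> try omega
    rename_i b
    rw [ih b (by omega)]
  | or φ₁ φ₂ ih₁ ih₂ =>
    intro ψ h
    cases ψ <;> simp only [encode] at h <;> try omega
    rename_i b q
    have := Nat.pair_eq_pair.1 (show Nat.pair (encode φ₁) (encode φ₂) = Nat.pair (encode b) (encode q) by omega)
    rw [ih₁ _ this.1, ih₂ _ this.2]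
  | until_ φ₁ φ₂ ih₁ ih₂ =>
    intro ψ h
    cases ψ <;> simp only [encode] at h <;> try omega
    rename_i b q
    have := Nat.pair_eq_pair.1 (show Nat.pair (encode φ₁) (encode φ₂) = Nat.pair (encode b) (encode q) by omega)
    rw [ih₁ _ this.1, ih₂ _ this.2]
  | ex p φ ih =>
    intro ψ h
    cases ψ <;> simp only [encode] at h <;> try omega
    rename_i b q
    have := Nat.pair_eq_pair.1 (show Nat.pair p (encode φ) = Nat.pair b (encode q) by omega)
    rw [this.1, ih _ this.2]
  | all p φ ih =>
    intro ψ h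
    cases ψ <;> simp only [encode] at h <;> try omega
    rename_i b q
    have := Nat.pair_eq_pair.1 (show Nat.pair p (encode φ) = Nat.pair b (encode q) by omega)
    rw [this.1, ih _ this.2]

/-! ### Derived connectives -/

def conj (a b : HLTL) : HLTL := neg (or (neg a) (neg b))
def ev (a : HLTL) : HLTL := until_ tt a
def nextN : ℕ → HLTL → HLTL
  | 0, φ => φ
  | n + 1, φ => next (nextN n φ)
def allN : ℕ → HLTL → HLTL
  | 0, φ => φ
  | k + 1, φ => all k (allN k φ)

theorem shift_shift (A : ℕ → Trace) (i j : ℕ) : shift (shift A i) j = shift A (j + i) := by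
  funext p n; simp [shift, Nat.add_assoc]

theorem shift_zero (A : ℕ → Trace) : shift A 0 = A := by
  funext p n; simp [shift]

theorem sat_conj (T a b A) : sat T (conj a b) A ↔ sat T a A ∧ sat T b A := by
  simp only [conj, sat]; tauto

theorem sat_ev (T a A) : sat T (ev a) A ↔ ∃ i, sat T a (shift A i) := by
  simp [ev, sat]

theorem sat_nextN (T n φ A) : sat T (nextN n φ) A ↔ sat T φ (shift A n) := by
  induction n generalizing A with
  | zero => simp [nextN, shift_zero]
  | succ n ih => simp only [nextN, sat, ih, shift_shift]

theorem sat_allN (T k φ A) : sat T (allN k φ) A ↔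
    ∀ s : ℕ → Trace, (∀ i < k, s i ∈ T) → sat T φ (fun i => if i < k then s i else A i) := by
  induction k generalizing A with
  | zero => simp [allN]
  | succ k ih =>
    simp only [allN, sat, ih]
    constructor
    · intro h s hs
      have := h (s k) (hs k (by omega)) s (fun i hi => hs i (by omega))
      convert this using 2 with i
      simp only [Function.update_apply]
      split_ifs <;> first | rfl | omega | (subst_vars; rfl)
    · intro h t ht s hs
      have := h (fun i => if i < k then s i else t)
        (fun i hi => by split_ifs with h1; exacts [hs i h1, ht])
      convert this using 2 with i
      simp only [Function.update_apply]
      split_ifs <;> first | rfl | omega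

/-! ### Quantifier-free arithmetic matrices -/

inductive Mx : Type
  | rel : ℕ → Fin 10 → Fin 10 → Mx
  | suc : Fin 10 → Fin 10 → Mx
  | lt : Fin 10 → Fin 10 → Mx
  | cst : ℕ → Fin 10 → Mx
  | imp : Mx → Mx → Mx
  | and : Mx → Mx → Mx
  | no : Mx → Mx

def Mx.holds (R : ℕ → ℕ → ℕ → Prop) (v : Fin 10 → ℕ) : Mx → Prop
  | .rel r i j => R r (v i) (v j)
  | .suc i j => v j = v i + 1
  | .lt i j => v i < v j
  | .cst n i => v i = n
  | .imp a b => a.holds R v → b.holds R v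
  | .and a b => a.holds R v ∧ b.holds R v
  | .no a => ¬ a.holds R v

def Mx.toH : Mx → HLTL
  | .rel r i j => ev (conj (atom (r + 1) i) (atom 0 j))
  | .suc i j => ev (conj (atom 0 i) (next (atom 0 j)))
  | .lt i j => ev (conj (atom 0 i) (next (ev (atom 0 j))))
  | .cst n i => nextN n (atom 0 i)
  | .imp a b => or (neg a.toH) b.toH
  | .and a b => conj a.toH b.toH
  | .no a => neg a.toH

theorem Mx.sat_toH (T : Set Trace) (R : ℕ → ℕ → ℕ → Prop) (v : Fin 10 → ℕ) (A : ℕ → Trace)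
    (h0 : ∀ (i : Fin 10) y, 0 ∈ A i y ↔ y = v i)
    (h1 : ∀ (i : Fin 10) r y, r + 1 ∈ A i y ↔ R r (v i) y) (m : Mx) :
    sat T m.toH A ↔ m.holds R v := by
  induction m with
  | rel r i j => simp [toH, holds, sat_ev, sat_conj, sat, shift, h0, h1]
  | suc i j =>
    simp [toH, holds, sat_ev, sat_conj, sat, shift, h0]
    omega
  | lt i j =>
    simp only [toH, holds, sat_ev, sat_conj, sat, shift, h0]
    constructor
    · rintro ⟨a, b, c, d⟩; omega
    · intro h; exact ⟨v i, by omega, v j - v i - 1, by omega⟩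
  | cst n i =>
    simp only [toH, holds, sat_nextN, sat, shift, h0]
    omega
  | imp a b iha ihb => simp only [toH, holds, sat, iha, ihb]; tauto
  | and a b iha ihb => simp only [toH, holds, sat_conj, iha, ihb]
  | no a iha => simp only [toH, holds, sat, iha]

/-! ### The sentence attached to a matrix -/

def uniq : HLTL := until_ (neg (atom 0 0)) (conj (atom 0 0) (next (neg (ev (atom 0 0)))))

def frame : HLTL :=
  conj uniq (conj (atom 0 11) (ev (conj (atom 0 0) (next (atom 0 10)))))

def sentence (φ : HLTL) : HLTL := allN 10 (ex 10 (ex 11 (conj frame φ)))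

theorem sat_uniq (T A) : sat T uniq A ↔ ∃ n, ∀ y, 0 ∈ A 0 y ↔ y = n := by
  simp only [uniq, sat, sat_conj, sat_ev, shift, Nat.zero_add]
  constructor
  · rintro ⟨i, ⟨h1, h2⟩, h3⟩
    refine ⟨i, fun y => ⟨fun hy => ?_, fun hy => hy ▸ h1⟩⟩
    rcases lt_trichotomy y i with h | h | h
    · exact absurd hy (h3 y h)
    · exact h
    · exact absurd ⟨y - i - 1, by rwa [show y - i - 1 + 1 + i = y by omega]⟩ h2
  · rintro ⟨n, hn⟩
    refine ⟨n, ⟨(hn n).2 rfl, ?_⟩, fun j hj h => ?_⟩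
    · rintro ⟨y, hy⟩
      have := (hn _).1 hy
      omega
    · have := (hn _).1 h
      omega

theorem satisfiable_sentence (m : Mx) : Satisfiable (sentence m.toH) ↔
    ∃ R : ℕ → ℕ → ℕ → Prop, ∀ v, m.holds R v := by
  constructor
  · rintro ⟨T, ⟨t0, ht0⟩, h⟩
    have h := h (fun _ => t0)
    simp only [sentence, sat_allN, sat, sat_conj, frame, sat_uniq, sat_ev] at h
    have key : ∀ t ∈ T, (∃ n, ∀ y, 0 ∈ t y ↔ y = n) ∧ (∃ t' ∈ T, 0 ∈ t' 0) ∧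
        ∃ t' ∈ T, ∃ i, 0 ∈ t i ∧ 0 ∈ t' (i + 1) := by
      intro t ht
      obtain ⟨t1, ht1, t2, ht2, ⟨hu, hz, i, hs⟩, -⟩ := h (fun _ => t) (fun _ _ => ht)
      refine ⟨by simpa using hu, ⟨t2, ht2, by simpa using hz⟩, t1, ht1, i, ?_⟩
      simpa [shift, Nat.add_comm] using hs
    have ex : ∀ n, ∃ t ∈ T, ∀ y, 0 ∈ t y ↔ y = n := by
      intro n
      induction n with
      | zero =>
        obtain ⟨-, ⟨t', ht', h0⟩, -⟩ := key t0 ht0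
        obtain ⟨⟨n, hn⟩, -⟩ := key t' ht'
        have := (hn _).1 h0
        subst this
        exact ⟨t', ht', hn⟩
      | succ n ih =>
        obtain ⟨t, ht, hn⟩ := ih
        obtain ⟨-, -, t', ht', i, hi, hi'⟩ := key t ht
        obtain ⟨⟨k, hk⟩, -⟩ := key t' ht'
        have e1 := (hn _).1 hi
        have e2 := (hk _).1 hi'
        subst e1 e2
        exact ⟨t', ht', hk⟩
    choose τ hτ hmark using ex
    refine ⟨fun r x y => r + 1 ∈ τ x y, fun v => ?_⟩
    obtain ⟨t1, ht1, t2, ht2, -, hm⟩ :=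
      h (fun i => if hi : i < 10 then τ (v ⟨i, hi⟩) else t0) (fun i hi => by simp [hi, hτ])
    have hA : ∀ i : Fin 10, (Function.update (Function.update (fun i => if i < 10 then
        (if hi : i < 10 then τ (v ⟨i, hi⟩) else t0) else t0) 10 t1) 11 t2) i = τ (v i) := by
      intro i
      have := i.2
      rw [Function.update_of_ne (by omega), Function.update_of_ne (by omega)]
      simp
    refine (Mx.sat_toH T _ v _ ?_ ?_ m).1 hm
    · intro i y; rw [hA, hmark]
    · intro i r y; rw [hA]
  · rintro ⟨R, hR⟩
    let tr : ℕ → Trace := fun x y => {p | (p = 0 ∧ y = x) ∨ ∃ r, p = r + 1 ∧ R r x y}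
    have tr0 : ∀ x y, 0 ∈ tr x y ↔ y = x := by intro x y; simp [tr]
    have tr1 : ∀ x r y, r + 1 ∈ tr x y ↔ R r x y := by intro x r y; simp [tr]
    refine ⟨Set.range tr, ⟨tr 0, 0, rfl⟩, fun A => ?_⟩
    simp only [sentence, sat_allN, sat, sat_conj, frame, sat_uniq, sat_ev]
    intro s hs
    choose v hv using fun i : Fin 10 => hs i i.2
    have hA : ∀ t1 t2, ∀ i : Fin 10, (Function.update (Function.update
        (fun i => if i < 10 then s i else A i) 10 t1) 11 t2) i = tr (v i) := by
      intro t1 t2 i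
      have := i.2
      rw [Function.update_of_ne (by omega), Function.update_of_ne (by omega), hv]
      simp
    refine ⟨_, ⟨v 0 + 1, rfl⟩, _, ⟨0, rfl⟩, ⟨⟨v 0, ?_⟩, ?_, v 0, ?_⟩, ?_⟩
    · intro y
      have := hA (tr (v 0 + 1)) (tr 0) 0
      rw [Fin.val_zero] at this
      rw [this, tr0]
    · simp [tr0]
    · have := hA (tr (v 0 + 1)) (tr 0) 0
      rw [Fin.val_zero] at this
      simp only [shift, this, tr0]
      simp [tr0, Nat.add_comm]
    · refine (Mx.sat_toH _ R v _ ?_ ?_ m).2 (hR v)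
      · intro i y; rw [hA, tr0]
      · intro i r y; rw [hA, tr1]

/-! ### Syntactic well-formedness -/

theorem quantFree_nextN (n φ) : quantFree (nextN n φ) = quantFree φ := by
  induction n with
  | zero => rfl
  | succ n ih => simpa [nextN, quantFree] using ih

theorem free_nextN (n φ) : free (nextN n φ) = free φ := by
  induction n with
  | zero => rfl
  | succ n ih => simpa [nextN, free] using ih

theorem Mx.quantFree_toH (m : Mx) : quantFree m.toH = true := by
  induction m <;> simp_all [toH, quantFree, conj, ev, quantFree_nextN]

theorem Mx.free_toH (m : Mx) : ∀ i ∈ free m.toH, i < 10 := by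
  induction m with
  | imp a b iha ihb =>
    intro i hi
    simp only [toH, free, Finset.mem_union] at hi
    exact hi.elim (iha i) (ihb i)
  | and a b iha ihb =>
    intro i hi
    simp only [toH, conj, free, Finset.mem_union] at hi
    exact hi.elim (iha i) (ihb i)
  | no a iha => exact iha
  | cst n j =>
    intro i hi
    simp only [toH, free_nextN, free, Finset.mem_singleton] at hi
    omega
  | _ =>
    intro i hi
    simp [toH, conj, ev, free] at hi
    omega

theorem prenex_of_quantFree (φ) (h : quantFree φ = true) : prenex φ = true := by
  cases φ <;> simp_all [prenex, quantFree]

theorem prenex_allN (k φ) : prenex (allN k φ) = prenex φ := by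
  induction k with
  | zero => rfl
  | succ n ih => simpa [allN, prenex] using ih

theorem free_allN (k φ i) (h : i ∈ free (allN k φ)) : i ∈ free φ ∧ k ≤ i := by
  induction k with
  | zero => exact ⟨h, by omega⟩
  | succ n ih =>
    simp only [allN, free, Finset.mem_erase] at h
    obtain ⟨h1, h2⟩ := ih h.2
    exact ⟨h1, by omega⟩

theorem sentence_ok (m : Mx) : Sentence (sentence m.toH) := by
  constructor
  · rw [sentence, prenex_allN]
    simp only [prenex]
    apply prenex_of_quantFree
    simp [conj, quantFree, frame, uniq, ev, m.quantFree_toH]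
  · rw [Finset.eq_empty_iff_forall_notMem]
    intro i hi
    obtain ⟨h1, h2⟩ := free_allN _ _ _ hi
    simp [conj, free, frame, uniq, ev] at h1
    have := m.free_toH i
    grind

/-! ### Matrix for a partial recursive code -/

open Nat.Partrec (Code)
open Nat.Partrec.Code

/-- relation symbol for a code -/
def sy (c : Code) : ℕ := Encodable.encode c

def Lf (i j : Fin 10) : Mx := .rel (sy .left) i j
def Rt (i j : Fin 10) : Mx := .rel (sy .right) i j

/-- The pairing axioms. -/
def pairAx : Mx :=
  .and (.imp (.cst 0 0) (.and (Lf 0 0) (Rt 0 0))) <|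
  .and (.imp (Lf 0 1) <| .imp (Rt 0 2) <| .imp (.suc 0 3) <| .imp (.suc 1 4) <| .imp (.lt 4 2) <|
    .and (Lf 3 4) (Rt 3 2)) <|
  .and (.imp (Lf 0 1) <| .imp (Rt 0 2) <| .imp (.suc 0 3) <| .imp (.suc 1 2) <| .imp (.cst 0 4) <|
    .and (Lf 3 2) (Rt 3 4)) <|
  .and (.imp (Lf 0 1) <| .imp (Rt 0 2) <| .imp (.suc 0 3) <| .imp (.lt 2 1) <| .imp (.suc 2 4) <|
    .and (Lf 3 1) (Rt 3 4)) <|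
  (.imp (Lf 0 1) <| .imp (Rt 0 1) <| .imp (.suc 0 3) <| .imp (.suc 1 2) <| .imp (.cst 0 4) <|
    .and (Lf 3 4) (Rt 3 2))

def codeAx : Code → Mx
  | .zero => .imp (.cst 0 1) (.rel (sy .zero) 0 1)
  | .succ => .imp (.suc 0 1) (.rel (sy .succ) 0 1)
  | .left => pairAx
  | .right => pairAx
  | .pair f g => .and (codeAx f) <| .and (codeAx g) <|
      .imp (Lf 3 1) <| .imp (Rt 3 2) <| .imp (.rel (sy f) 0 1) <| .imp (.rel (sy g) 0 2) <|
        .rel (sy (.pair f g)) 0 3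
  | .comp f g => .and (codeAx f) <| .and (codeAx g) <|
      .imp (.rel (sy g) 0 1) <| .imp (.rel (sy f) 1 2) <| .rel (sy (.comp f g)) 0 2
  | .prec f g => .and (codeAx f) <| .and (codeAx g) <|
      .and (.imp (Lf 0 1) <| .imp (Rt 0 2) <| .imp (.cst 0 2) <| .imp (.rel (sy f) 1 3) <|
        .rel (sy (.prec f g)) 0 3)
      -- 0 = (a, n), 1 = a, 2 = n, 3 = value, 4 = (n, value), 5 = (a, (n, value)), 6 = new value
      (.imp (Lf 0 1) <| .imp (Rt 0 2) <| .imp (.rel (sy (.prec f g)) 0 3) <|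
        .imp (Lf 4 2) <| .imp (Rt 4 3) <| .imp (Lf 5 1) <| .imp (Rt 5 4) <|
        .imp (.rel (sy g) 5 6) <| .imp (.suc 2 7) <| .imp (Lf 8 1) <| .imp (Rt 8 7) <|
        .rel (sy (.prec f g)) 8 6)
  | .rfind' f => .and (codeAx f) <|
      .and (.imp (Rt 0 2) <| .imp (.cst 0 3) <| .imp (.rel (sy f) 0 3) <|
        .rel (sy (.rfind' f)) 0 2)
      (.imp (Lf 0 1) <| .imp (Rt 0 2) <| .imp (.rel (sy f) 0 4) <| .imp (.lt 3 4) <|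
        .imp (.suc 2 5) <| .imp (Lf 6 1) <| .imp (Rt 6 5) <| .imp (.rel (sy (.rfind' f)) 6 7) <|
        .rel (sy (.rfind' f)) 0 7)

/-- Intended interpretation. -/
def stdR (r x y : ℕ) : Prop := ∃ c : Code, sy c = r ∧ y ∈ c.eval x

theorem stdR_sy (c : Code) (x y) : stdR (sy c) x y ↔ y ∈ c.eval x := by
  constructor
  · rintro ⟨d, hd, h⟩
    rwa [← Encodable.encode_injective hd]
  · exact fun h => ⟨c, rfl, h⟩

theorem unpair_step (p : ℕ) :
    Nat.unpair (p + 1) =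
      if (Nat.unpair p).1 + 1 < (Nat.unpair p).2 then ((Nat.unpair p).1 + 1, (Nat.unpair p).2)
      else if (Nat.unpair p).1 + 1 = (Nat.unpair p).2 then ((Nat.unpair p).2, 0)
      else if (Nat.unpair p).2 < (Nat.unpair p).1 then ((Nat.unpair p).1, (Nat.unpair p).2 + 1)
      else (0, (Nat.unpair p).1 + 1) := by
  obtain ⟨a, b, rfl⟩ : ∃ a b, p = Nat.pair a b := ⟨_, _, (Nat.pair_unpair p).symm⟩
  simp only [Nat.unpair_pair]
  have key : ∀ q : ℕ × ℕ, Nat.pair a b + 1 = Nat.pair q.1 q.2 → Nat.unpair (Nat.pair a b + 1) = q := by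
    intro q h; rw [h, Nat.unpair_pair]
  apply key
  split_ifs with h1 h2 h3 <;> simp only [Nat.pair]
  · rw [if_pos (by omega), if_pos (by omega)]; ring
  · subst h2
    rw [if_pos (by omega), if_neg (by omega)]; ring
  · rw [if_neg (by omega), if_neg (by omega)]; ring
  · have : a = b := by omega
    subst this
    rw [if_neg (by omega), if_pos (by omega)]; ring

theorem std_left (x y) : stdR (sy .left) x y ↔ y = (Nat.unpair x).1 := by
  rw [stdR_sy]; simp [Code.eval]
theorem std_right (x y) : stdR (sy .right) x y ↔ y = (Nat.unpair x).2 := by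
  rw [stdR_sy]; simp [Code.eval]

theorem std_pairAx (v) : pairAx.holds stdR v := by
  simp only [pairAx, Mx.holds, Lf, Rt, std_left, std_right]
  refine ⟨?_, ?_, ?_, ?_, ?_⟩
  · intro h; simp [h]
  · intro h1 h2 h3 h4 h5
    rw [h3, unpair_step, if_pos (by omega)]; exact ⟨by omega, by omega⟩
  · intro h1 h2 h3 h4 h5
    rw [h3, unpair_step, if_neg (by omega), if_pos (by omega)]; exact ⟨by omega, by omega⟩
  · intro h1 h2 h3 h4 h5
    rw [h3, unpair_step, if_neg (by omega), if_neg (by omega), if_pos (by omega)]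
    exact ⟨by omega, by omega⟩
  · intro h1 h2 h3 h4 h5
    rw [h3, unpair_step, if_neg (by omega), if_neg (by omega), if_neg (by omega)]
    exact ⟨by omega, by omega⟩

theorem eq_pair {x a b : ℕ} (h1 : a = (Nat.unpair x).1) (h2 : b = (Nat.unpair x).2) :
    x = Nat.pair a b := by rw [h1, h2, Nat.pair_unpair]

theorem mem_rfind' (f : Code) (a m z : ℕ) : z ∈ (Code.rfind' f).eval (Nat.pair a m) ↔
    ∃ n, z = n + m ∧ 0 ∈ f.eval (Nat.pair a (n + m)) ∧
      ∀ k < n, ∃ w, 0 < w ∧ w ∈ f.eval (Nat.pair a (k + m)) := by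
  simp only [Code.eval, Nat.unpaired, Nat.unpair_pair, Part.mem_map_iff, Part.map_eq_map]
  constructor
  · rintro ⟨n, hn, rfl⟩
    obtain ⟨h12, h3⟩ := Nat.mem_rfind.1 hn
    obtain ⟨w, h1, h2⟩ := (Part.mem_map_iff _).1 h12
    refine ⟨n, rfl, ?_, fun k hk => ?_⟩
    · simp at h2; rwa [h2] at h1
    · obtain ⟨w, h4, h5⟩ := (Part.mem_map_iff _).1 (h3 hk)
      simp at h5
      exact ⟨w, by omega, h4⟩
  · rintro ⟨n, rfl, h1, h2⟩
    refine ⟨n, Nat.mem_rfind.2 ⟨(Part.mem_map_iff _).2 ⟨0, h1, by simp⟩, fun {k} hk => ?_⟩, rfl⟩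
    obtain ⟨w, h3, h4⟩ := h2 k hk
    exact (Part.mem_map_iff _).2 ⟨w, h4, by simp; omega⟩

theorem std_codeAx (c : Code) (v) : (codeAx c).holds stdR v := by
  induction c with
  | zero =>
    simp only [codeAx, Mx.holds, stdR_sy, Code.eval]
    intro h; rw [h]; exact Part.mem_some _
  | succ => simp [codeAx, Mx.holds, stdR_sy, Code.eval]
  | left => exact std_pairAx v
  | right => exact std_pairAx v
  | pair f g ihf ihg =>
    refine ⟨ihf, ihg, ?_⟩
    simp only [Mx.holds, Lf, Rt, std_left, std_right]
    simp only [stdR_sy]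
    intro h1 h2 h3 h4
    rw [eq_pair h1 h2]
    simp only [Code.eval, Seq.seq, Part.mem_bind_iff, Part.map_eq_map, Part.mem_map_iff]
    exact ⟨_, ⟨_, h3, rfl⟩, _, h4, rfl⟩
  | comp f g ihf ihg =>
    refine ⟨ihf, ihg, ?_⟩
    simp only [Mx.holds, stdR_sy]
    intro h1 h2
    exact Part.mem_bind_iff.2 ⟨_, h1, h2⟩
  | prec f g ihf ihg =>
    refine ⟨ihf, ihg, ?_, ?_⟩
    · simp only [Mx.holds, Lf, Rt, std_left, std_right]
      simp only [stdR_sy]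
      intro h1 h2 h3 h4
      rw [eq_pair h1 h2, h3, Code.eval_prec_zero]
      exact h4
    · simp only [Mx.holds, Lf, Rt, std_left, std_right]
      simp only [stdR_sy]
      intro h1 h2 h3 h4 h5 h6 h7 h8 h9 h10 h11
      rw [eq_pair h10 h11, h9, Code.eval_prec_succ]
      rw [eq_pair h1 h2] at h3
      rw [eq_pair h6 h7, eq_pair h4 h5] at h8
      exact Part.mem_bind_iff.2 ⟨_, h3, h8⟩
  | rfind' f ihf =>
    refine ⟨ihf, ?_, ?_⟩
    · simp only [Mx.holds, Rt, std_right]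
      simp only [stdR_sy]
      intro h2 h3 h4
      have e := eq_pair rfl h2
      rw [e] at h4 ⊢
      rw [mem_rfind']
      exact ⟨0, by simp, by simpa [h3] using h4, by simp⟩
    · simp only [Mx.holds, Lf, Rt, std_left, std_right]
      simp only [stdR_sy]
      intro h1 h2 h3 h4 h5 h6 h7 h8
      rw [eq_pair h6 h7, mem_rfind'] at h8
      rw [eq_pair h1 h2] at h3 ⊢
      rw [mem_rfind']
      obtain ⟨n, e, h9, h10⟩ := h8
      rw [h5] at *
      refine ⟨n + 1, by omega, by convert h9 using 2; congr 1; omega, ?_⟩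
      rintro (_ | k) hk
      · exact ⟨v 4, by omega, by simpa using h3⟩
      · obtain ⟨w, hw, hw'⟩ := h10 k (by omega)
        exact ⟨w, hw, by convert hw' using 2; congr 1; omega⟩

/-! ### Every model contains all true facts -/

theorem compl_pair (R) (h : ∀ v, pairAx.holds R v) (p : ℕ) :
    R (sy .left) p (Nat.unpair p).1 ∧ R (sy .right) p (Nat.unpair p).2 := by
  simp only [pairAx, Mx.holds, Lf, Rt] at h
  induction p with
  | zero => simpa using (h (fun _ => 0)).1
  | succ p ih =>
    obtain ⟨ih1, ih2⟩ := ih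
    rw [unpair_step]
    generalize (Nat.unpair p).1 = a at *
    generalize (Nat.unpair p).2 = b at *
    split_ifs with h1 h2 h3
    · exact (h ![p, a, b, p + 1, a + 1, 0, 0, 0, 0, 0]).2.1 ih1 ih2 rfl rfl h1
    · exact (h ![p, a, b, p + 1, 0, 0, 0, 0, 0, 0]).2.2.1 ih1 ih2 rfl h2.symm rfl
    · exact (h ![p, a, b, p + 1, b + 1, 0, 0, 0, 0, 0]).2.2.2.1 ih1 ih2 rfl h3 rfl
    · have e : b = a := by omega
      rw [e] at ih2
      exact (h ![p, a, a + 1, p + 1, 0, 0, 0, 0, 0, 0]).2.2.2.2 ih1 ih2 rfl rfl rfl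

theorem compl_code (R) (hp : ∀ v, pairAx.holds R v) (c : Code) (h : ∀ v, (codeAx c).holds R v) :
    ∀ x y, y ∈ c.eval x → R (sy c) x y := by
  have hl : ∀ a b, R (sy .left) (Nat.pair a b) a := fun a b => by
    simpa using (compl_pair R hp (Nat.pair a b)).1
  have hr : ∀ a b, R (sy .right) (Nat.pair a b) b := fun a b => by
    simpa using (compl_pair R hp (Nat.pair a b)).2
  induction c with
  | zero =>
    intro x y hy
    have : y = 0 := by simpa [Code.eval, pure, PFun.pure] using hy
    exact h ![x, y, 0, 0, 0, 0, 0, 0, 0, 0] this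
  | succ =>
    intro x y hy
    have : y = x + 1 := by simpa [Code.eval] using hy
    exact h ![x, y, 0, 0, 0, 0, 0, 0, 0, 0] this
  | left =>
    intro x y hy
    have : y = (Nat.unpair x).1 := by simpa [Code.eval] using hy
    exact this ▸ (compl_pair R hp x).1
  | right =>
    intro x y hy
    have : y = (Nat.unpair x).2 := by simpa [Code.eval] using hy
    exact this ▸ (compl_pair R hp x).2
  | pair f g ihf ihg =>
    intro x y hy
    simp only [Code.eval, Seq.seq, Part.mem_bind_iff, Part.map_eq_map,
      Part.mem_map_iff] at hy
    obtain ⟨_, ⟨a, ha, rfl⟩, b, hb, rfl⟩ := hy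
    exact (h ![x, a, b, Nat.pair a b, 0, 0, 0, 0, 0, 0]).2.2 (hl a b) (hr a b)
      (ihf (fun v => (h v).1) _ _ ha) (ihg (fun v => (h v).2.1) _ _ hb)
  | comp f g ihf ihg =>
    intro x y hy
    obtain ⟨a, ha, hb⟩ := Part.mem_bind_iff.1 hy
    exact (h ![x, a, y, 0, 0, 0, 0, 0, 0, 0]).2.2
      (ihg (fun v => (h v).2.1) _ _ ha) (ihf (fun v => (h v).1) _ _ hb)
  | prec f g ihf ihg =>
    intro x y hy
    obtain ⟨a, n, rfl⟩ : ∃ a b, x = Nat.pair a b := ⟨_, _, (Nat.pair_unpair x).symm⟩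
    induction n generalizing y with
    | zero =>
      rw [Code.eval_prec_zero] at hy
      exact (h ![Nat.pair a 0, a, 0, y, 0, 0, 0, 0, 0, 0]).2.2.1 (hl a 0) (hr a 0) rfl
        (ihf (fun v => (h v).1) _ _ hy)
    | succ n ih =>
      rw [Code.eval_prec_succ] at hy
      obtain ⟨w, hw, hy⟩ := Part.mem_bind_iff.1 hy
      exact (h ![Nat.pair a n, a, n, w, Nat.pair n w, Nat.pair a (Nat.pair n w), y, n + 1,
        Nat.pair a (n + 1), 0]).2.2.2 (hl _ _) (hr _ _) (ih _ hw) (hl _ _) (hr _ _) (hl _ _)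
        (hr _ _) (ihg (fun v => (h v).2.1) _ _ hy) rfl (hl _ _) (hr _ _)
  | rfind' f ihf =>
    intro x y hy
    obtain ⟨a, m, rfl⟩ : ∃ a b, x = Nat.pair a b := ⟨_, _, (Nat.pair_unpair x).symm⟩
    rw [mem_rfind'] at hy
    obtain ⟨n, rfl, h0, hlt⟩ := hy
    have ihf := ihf (fun v => (h v).1)
    induction n generalizing m with
    | zero =>
      simp only [Nat.zero_add] at h0 ⊢
      exact (h ![Nat.pair a m, a, m, 0, 0, 0, 0, 0, 0, 0]).2.1 (hr _ _) rfl (ihf _ _ h0)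
    | succ n ih =>
      obtain ⟨w, hw, hw'⟩ := hlt 0 (by omega)
      rw [Nat.zero_add] at hw'
      have := ih (m + 1) (by convert h0 using 2; congr 1; omega) (fun k hk => by
        obtain ⟨w, hw, hw'⟩ := hlt (k + 1) (by omega)
        exact ⟨w, hw, by convert hw' using 2; congr 1; omega⟩)
      rw [show n + 1 + m = n + (m + 1) by omega]
      exact (h ![Nat.pair a m, a, m, 0, w, m + 1, Nat.pair a (m + 1), n + (m + 1), 0, 0]).2.2
        (hl _ _) (hr _ _) (ihf _ _ hw') hw rfl (hl _ _) (hr _ _) this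

/-! ### The reduction -/

def mxOf (c : Code) (n : ℕ) : Mx :=
  .and (.and pairAx (codeAx c)) (.imp (.cst n 0) (.no (.rel (sy c) 0 1)))

theorem satisfiable_mxOf (c : Code) (n : ℕ) :
    Satisfiable (sentence (mxOf c n).toH) ↔ ¬ (c.eval n).Dom := by
  rw [satisfiable_sentence]
  constructor
  · rintro ⟨R, h⟩ hd
    obtain ⟨y, hy⟩ := Part.dom_iff_mem.1 hd
    exact (h ![n, y, 0, 0, 0, 0, 0, 0, 0, 0]).2 rfl
      (compl_code R (fun v => (h v).1.1) c (fun v => (h v).1.2) n y hy)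
  · intro hd
    refine ⟨stdR, fun v => ⟨⟨std_pairAx v, std_codeAx c v⟩, ?_⟩⟩
    simp only [Mx.holds, stdR_sy]
    intro e hm
    rw [e] at hm
    exact hd (Part.dom_iff_mem.2 ⟨_, hm⟩)

theorem encode_nextN (n φ) : encode (nextN n φ) = (fun x => 8 * x + 4)^[n] (encode φ) := by
  induction n with
  | zero => rfl
  | succ n ih => rw [Function.iterate_succ_apply', ← ih]; rfl

theorem primrec_tag (k : ℕ) {f : ℕ → ℕ} (hf : Primrec f) : Primrec (fun n => 8 * f n + k) :=
  Primrec.nat_add.comp (Primrec.nat_mul.comp (Primrec.const 8) hf) (Primrec.const k)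

theorem primrec_pair {f g : ℕ → ℕ} (hf : Primrec f) (hg : Primrec g) :
    Primrec (fun n => Nat.pair (f n) (g n)) := Primrec₂.natPair.comp hf hg

theorem primrec_allN (k : ℕ) {F : ℕ → HLTL} (hF : Primrec (fun n => encode (F n))) :
    Primrec (fun n => encode (allN k (F n))) := by
  induction k with
  | zero => exact hF
  | succ k ih => exact primrec_tag 7 (primrec_pair (Primrec.const k) ih)

theorem primrec_conj {F G : ℕ → HLTL} (hF : Primrec (fun n => encode (F n)))
    (hG : Primrec (fun n => encode (G n))) :
    Primrec (fun n => encode (conj (F n) (G n))) :=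
  primrec_tag 2 (primrec_tag 3 (primrec_pair (primrec_tag 2 hF) (primrec_tag 2 hG)))

theorem primrec_encode (c : Code) : Primrec (fun n => encode (sentence (mxOf c n).toH)) := by
  refine primrec_allN 10 (primrec_tag 6 (primrec_pair (Primrec.const 10)
    (primrec_tag 6 (primrec_pair (Primrec.const 11)
    (primrec_conj (Primrec.const _) (primrec_conj (Primrec.const _)
      (primrec_tag 3 (primrec_pair (primrec_tag 2 ?_) (Primrec.const _)))))))))
  simp only [Mx.toH, encode_nextN]
  exact Primrec.nat_iterate Primrec.id (Primrec.const _) (primrec_tag 4 Primrec.id |>.comp Primrec.snd)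

theorem exists_universal : ∃ c : Code, ¬ ComputablePred (fun n => (c.eval n).Dom) := by
  have hp : Nat.Partrec (fun n => (Denumerable.ofNat Code n).eval 0) :=
    Partrec.nat_iff.1 (Code.eval_part.comp (Computable.ofNat Code) (Computable.const 0))
  obtain ⟨c, hc⟩ := Code.exists_code.1 hp
  refine ⟨c, fun h => ComputablePred.halting_problem 0 ?_⟩
  refine ComputablePred.computable_of_manyOneReducible ⟨Encodable.encode, Computable.encode, ?_⟩ h
  intro d
  rw [hc]
  simp

end HLTL

/-- HyperLTL-SAT is undecidable: the set of Gödel codes of satisfiable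
HyperLTL formulas is not a computable (decidable) predicate on ℕ. -/
theorem hyperLTLSat_undecidable : ¬ ComputablePred HyperLTLSatCode := by
  intro h
  obtain ⟨c, hc⟩ := HLTL.exists_universal
  apply hc
  have h2 : ComputablePred (fun n => ¬ (c.eval n).Dom) := by
    refine ComputablePred.computable_of_manyOneReducible
      ⟨_, (HLTL.primrec_encode c).to_comp, fun n => ?_⟩ h
    refine (HLTL.satisfiable_mxOf c n).symm.trans ?_
    constructor
    · exact fun hs => ⟨_, HLTL.sentence_ok _, rfl, hs⟩
    · rintro ⟨ψ, -, e, hs⟩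
      rwa [HLTL.encode_inj _ _ e] at hs
  simpa using h2.not
end

section
/- For every fixed m ≥ 1, the bounded satisfiability problem for HyperLTL is decidable: the predicate 'the HyperLTL formula with Gödel code n is satisfiable by some nonempty trace set of cardinality at most m' is a computable (decidable) predicate on ℕ. -/
namespace HB

/-! ### Total decoding of codes -/

/-- Total decoding of natural numbers into formulas (invalid codes become `tt`). -/
def dec (n : ℕ) : HLTL :=
  if h : n % 8 = 0 then .tt
  else if n % 8 = 1 then .atom (n / 8).unpair.1 (n / 8).unpair.2
  else if n % 8 = 2 then .neg (dec (n / 8))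
  else if n % 8 = 3 then .or (dec (n / 8).unpair.1) (dec (n / 8).unpair.2)
  else if n % 8 = 4 then .next (dec (n / 8))
  else if n % 8 = 5 then .until_ (dec (n / 8).unpair.1) (dec (n / 8).unpair.2)
  else if n % 8 = 6 then .ex (n / 8).unpair.1 (dec (n / 8).unpair.2)
  else .all (n / 8).unpair.1 (dec (n / 8).unpair.2)
termination_by n
decreasing_by
  all_goals
    have h1 := Nat.unpair_left_le (n / 8)
    have h2 := Nat.unpair_right_le (n / 8)
    omega

theorem dec0 {n : ℕ} (h : n % 8 = 0) : dec n = .tt := by rw [dec]; simp [h]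
theorem dec1 {n : ℕ} (h : n % 8 = 1) : dec n = .atom (n / 8).unpair.1 (n / 8).unpair.2 := by
  rw [dec]; simp [h]
theorem dec2 {n : ℕ} (h : n % 8 = 2) : dec n = .neg (dec (n / 8)) := by rw [dec]; simp [h]
theorem dec3 {n : ℕ} (h : n % 8 = 3) :
    dec n = .or (dec (n / 8).unpair.1) (dec (n / 8).unpair.2) := by rw [dec]; simp [h]
theorem dec4 {n : ℕ} (h : n % 8 = 4) : dec n = .next (dec (n / 8)) := by rw [dec]; simp [h]
theorem dec5 {n : ℕ} (h : n % 8 = 5) :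
    dec n = .until_ (dec (n / 8).unpair.1) (dec (n / 8).unpair.2) := by rw [dec]; simp [h]
theorem dec6 {n : ℕ} (h : n % 8 = 6) :
    dec n = .ex (n / 8).unpair.1 (dec (n / 8).unpair.2) := by rw [dec]; simp [h]
theorem dec7 {n : ℕ} (h : n % 8 = 7) :
    dec n = .all (n / 8).unpair.1 (dec (n / 8).unpair.2) := by rw [dec]; simp [h]

theorem dec_encode (φ : HLTL) : dec φ.encode = φ := by
  induction φ with
  | tt => exact dec0 rfl
  | atom a π =>
    rw [HLTL.encode, dec1 (by omega), show (8 * Nat.pair a π + 1) / 8 = Nat.pair a π by omega]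
    simp
  | neg φ ih =>
    rw [HLTL.encode, dec2 (by omega), show (8 * φ.encode + 2) / 8 = φ.encode by omega, ih]
  | or φ ψ ih1 ih2 =>
    rw [HLTL.encode, dec3 (by omega),
      show (8 * Nat.pair φ.encode ψ.encode + 3) / 8 = Nat.pair φ.encode ψ.encode by omega]
    simp [ih1, ih2]
  | next φ ih =>
    rw [HLTL.encode, dec4 (by omega), show (8 * φ.encode + 4) / 8 = φ.encode by omega, ih]
  | until_ φ ψ ih1 ih2 =>
    rw [HLTL.encode, dec5 (by omega),
      show (8 * Nat.pair φ.encode ψ.encode + 5) / 8 = Nat.pair φ.encode ψ.encode by omega]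
    simp [ih1, ih2]
  | ex π φ ih =>
    rw [HLTL.encode, dec6 (by omega),
      show (8 * Nat.pair π φ.encode + 6) / 8 = Nat.pair π φ.encode by omega]
    simp [ih]
  | all π φ ih =>
    rw [HLTL.encode, dec7 (by omega),
      show (8 * Nat.pair π φ.encode + 7) / 8 = Nat.pair π φ.encode by omega]
    simp [ih]

theorem free_le_encode (φ : HLTL) : ∀ π ∈ φ.free, π ≤ φ.encode := by
  induction φ with
  | tt => simp [HLTL.free]
  | atom a π =>
    have := Nat.right_le_pair a π
    simp [HLTL.free, HLTL.encode]; omega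
  | neg φ ih | next φ ih =>
    intro π h; have := ih π h; simp only [HLTL.encode]; omega
  | or φ ψ ih1 ih2 | until_ φ ψ ih1 ih2 =>
    intro π h
    have h1 := Nat.left_le_pair φ.encode ψ.encode
    have h2 := Nat.right_le_pair φ.encode ψ.encode
    simp only [HLTL.free, Finset.mem_union] at h
    simp only [HLTL.encode]
    rcases h with h | h
    · have := ih1 π h; omega
    · have := ih2 π h; omega
  | ex ρ φ ih | all ρ φ ih =>
    intro π h
    have h2 := Nat.right_le_pair ρ φ.encode
    simp only [HLTL.free, Finset.mem_erase] at h
    have := ih π h.2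
    simp only [HLTL.encode]; omega

/-- Satisfaction depends only on the free variables. -/
theorem sat_congr (T : Set Trace) (φ : HLTL) : ∀ A A' : ℕ → Trace,
    (∀ π ∈ φ.free, A π = A' π) → (HLTL.sat T φ A ↔ HLTL.sat T φ A') := by
  induction φ with
  | tt => intros; rfl
  | atom a π => intro A A' h; simp [HLTL.sat, h π (by simp [HLTL.free])]
  | neg φ ih => intro A A' h; exact not_congr (ih A A' h)
  | or φ ψ ih1 ih2 =>
    intro A A' h
    simp only [HLTL.free, Finset.mem_union] at h
    exact or_congr (ih1 _ _ fun π hp => h π (Or.inl hp)) (ih2 _ _ fun π hp => h π (Or.inr hp))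
  | next φ ih =>
    intro A A' h
    exact ih _ _ fun π hp => by funext k; simp only [HLTL.shift, h π hp]
  | until_ φ ψ ih1 ih2 =>
    intro A A' h
    simp only [HLTL.free, Finset.mem_union] at h
    simp only [HLTL.sat]
    have e1 : ∀ i, HLTL.sat T φ (HLTL.shift A i) ↔ HLTL.sat T φ (HLTL.shift A' i) := fun i =>
      ih1 _ _ fun π hp => by funext k; simp only [HLTL.shift, h π (Or.inl hp)]
    have e2 : ∀ i, HLTL.sat T ψ (HLTL.shift A i) ↔ HLTL.sat T ψ (HLTL.shift A' i) := fun i =>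
      ih2 _ _ fun π hp => by funext k; simp only [HLTL.shift, h π (Or.inr hp)]
    simp only [e1, e2]
  | ex ρ φ ih | all ρ φ ih =>
    intro A A' h
    simp only [HLTL.sat]
    have e : ∀ t, HLTL.sat T φ (Function.update A ρ t) ↔ HLTL.sat T φ (Function.update A' ρ t) :=
      fun t => ih _ _ fun π hp => by
        by_cases hπ : π = ρ
        · subst hπ; simp
        · simp [hπ]; exact h π (by simp [HLTL.free, hπ, hp])
    simp only [e]

/-! ### Lassos -/

/-- A folded version of the sequence `τ`. -/
def IsLasso {Γ U : Type} (τ : ℕ → Γ) (req ful : U → Γ → Prop) (f : ℕ → ℕ) (p N : ℕ) : Prop :=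
  p < N ∧ τ (f 0) = τ 0 ∧ (∀ i, i + 1 < N → τ (f (i + 1)) = τ (f i + 1)) ∧
  τ (f p) = τ (f (N - 1) + 1) ∧
  ∀ u, req u (τ (f p)) → ∃ j, p ≤ j ∧ j < N ∧ ful u (τ (f j))

theorem lasso_exists {Γ U : Type} [Fintype Γ] [Fintype U] (τ : ℕ → Γ) (req ful : U → Γ → Prop)
    (h : ∀ u i, req u (τ i) → ∃ j, i ≤ j ∧ ful u (τ j)) :
    ∃ f p N, IsLasso τ req ful f p N := by
  classical
  obtain ⟨g, hg⟩ := Finite.exists_infinite_fiber τ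
  have hg' : (τ ⁻¹' {g}).Infinite := Set.infinite_coe_iff.1 hg
  obtain ⟨p, hp⟩ := hg'.nonempty
  have hw : ∀ u, ∃ j, req u (τ p) → p ≤ j ∧ ful u (τ j) := by
    intro u
    by_cases hr : req u (τ p)
    · obtain ⟨j, hj⟩ := h u p hr
      exact ⟨j, fun _ => hj⟩
    · exact ⟨0, fun h => absurd h hr⟩
  choose w hw using hw
  obtain ⟨N, hN, hlt⟩ := hg'.exists_gt (p + Finset.univ.sup w)
  refine ⟨id, p, N, by omega, rfl, fun _ _ => rfl, ?_, ?_⟩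
  · have : N - 1 + 1 = N := by omega
    simp only [id, this]
    exact hp.trans hN.symm
  · intro u hu
    have := Finset.le_sup (f := w) (Finset.mem_univ u)
    exact ⟨w u, (hw u hu).1, by omega, (hw u hu).2⟩

theorem lasso_shrink {Γ U : Type} [Fintype Γ] [Fintype U] (τ : ℕ → Γ) (req ful : U → Γ → Prop)
    (f : ℕ → ℕ) (p N : ℕ) (hL : IsLasso τ req ful f p N)
    (hN : Fintype.card Γ * 2 * 2 ^ Fintype.card U < N) :
    ∃ f' p' N', N' < N ∧ IsLasso τ req ful f' p' N' := by
  classical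
  obtain ⟨hpN, h0, hs, hc, hf⟩ := hL
  have hw : ∀ u, ∃ j, req u (τ (f p)) → p ≤ j ∧ j < N ∧ ful u (τ (f j)) := by
    intro u
    by_cases hr : req u (τ (f p))
    · obtain ⟨j, hj⟩ := hf u hr
      exact ⟨j, fun _ => hj⟩
    · exact ⟨0, fun h => absurd h hr⟩
  choose w hw using hw
  let col : Fin N → (Γ × Bool) × (U → Bool) :=
    fun i => ((τ (f i), decide (p ≤ i.1)), fun u => decide (w u ≤ i.1))
  have key : ∃ i j : Fin N, i.1 < j.1 ∧ col i = col j := by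
    obtain ⟨x, y, hxy, he⟩ := Fintype.exists_ne_map_eq_of_card_lt col (by simpa using hN)
    rcases lt_or_gt_of_ne (fun h => hxy (Fin.ext h)) with h | h
    · exact ⟨x, y, h, he⟩
    · exact ⟨y, x, h, he.symm⟩
  obtain ⟨⟨i, hi⟩, ⟨j, hj⟩, hij, he⟩ := key
  simp only [col, Prod.mk.injEq, decide_eq_decide, funext_iff] at he hij
  obtain ⟨⟨heτ, hep⟩, hew⟩ := he
  obtain ⟨d, rfl⟩ : ∃ d, j = i + d := ⟨j - i, by omega⟩
  let f' : ℕ → ℕ := fun k => if k < i then f k else f (k + d)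
  have A : ∀ k, k ≤ i → τ (f' k) = τ (f k) := by
    intro k hk
    rcases hk.lt_or_eq with h | rfl
    · simp [f', h]
    · simp [f', heτ]
  have B : ∀ k, i ≤ k → f' k = f (k + d) := by
    intro k hk
    simp [f', not_lt.2 hk]
  have C : ∀ k, k < i → f' k = f k := by
    intro k hk
    simp [f', hk]
  have hclose : τ (f' (if p ≤ i then p else p - d)) = τ (f p) := by
    split_ifs with hp
    · exact A p hp
    · rw [B _ (by omega)]; congr 2; omega
  refine ⟨f', if p ≤ i then p else p - d, N - d, by omega, ?_, ?_, ?_, ?_, ?_⟩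
  · split_ifs <;> omega
  · rw [A 0 (by omega), h0]
  · intro k hk
    by_cases hki : k < i
    · rw [A _ (by omega), C _ hki]; exact hs k (by omega)
    · rw [B _ (by omega), B _ (by omega), ← hs (k + d) (by omega)]; congr 2; omega
  · rw [hclose, B _ (by omega), hc]; congr 3; omega
  · intro u hu
    rw [hclose] at hu
    obtain ⟨h1, h2, h3⟩ := hw u hu
    have h4 := hew u
    by_cases hwi : w u ≤ i
    · refine ⟨w u, ?_, by omega, ?_⟩
      · rw [if_pos (by omega)]; exact h1
      · rw [A _ hwi]; exact h3
    · refine ⟨w u - d, ?_, by omega, ?_⟩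
      · split_ifs <;> omega
      · rw [B _ (by omega), show w u - d + d = w u by omega]; exact h3

theorem lasso_bounded {Γ U : Type} [Fintype Γ] [Fintype U] (τ : ℕ → Γ) (req ful : U → Γ → Prop)
    (h : ∀ u i, req u (τ i) → ∃ j, i ≤ j ∧ ful u (τ j)) :
    ∃ f p N, N ≤ Fintype.card Γ * 2 * 2 ^ Fintype.card U ∧ IsLasso τ req ful f p N := by
  classical
  have hex : ∃ N, ∃ f p, IsLasso τ req ful f p N := by
    obtain ⟨f, p, N, hL⟩ := lasso_exists τ req ful h
    exact ⟨N, f, p, hL⟩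
  obtain ⟨f, p, hL⟩ := Nat.find_spec hex
  refine ⟨f, p, Nat.find hex, ?_, hL⟩
  by_contra hlt
  obtain ⟨f', p', N', hN', hL'⟩ := lasso_shrink τ req ful f p _ hL (not_le.1 hlt)
  exact Nat.find_min hex hN' ⟨f', p', hL'⟩

/-! ### Certificates -/

/-- Replace digit `a` (base `m`) of `σ` by `j`. -/
def upd (m σ a j : ℕ) : ℕ := σ % m ^ a + m ^ a * (j + m * (σ / m ^ (a + 1)))

/-- The assignment coded by `σ`. -/
def asg (t : ℕ → Trace) (m σ : ℕ) : ℕ → Trace := fun π => t (σ / m ^ π % m)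

theorem upd_lt {m n σ a j : ℕ} (hm : 1 ≤ m) (hσ : σ < m ^ (n + 1)) (ha : a ≤ n) (hj : j < m) :
    upd m σ a j < m ^ (n + 1) := by
  unfold upd
  have h1 : σ % m ^ a < m ^ a := Nat.mod_lt _ (Nat.pow_pos hm)
  obtain ⟨d, rfl⟩ := Nat.exists_eq_add_of_le ha
  have e : m ^ (a + d + 1) = m ^ (a + 1) * m ^ d := by ring
  have h2 : σ / m ^ (a + 1) < m ^ d := Nat.div_lt_of_lt_mul (by rw [← e]; exact hσ)
  have h3 : m * (σ / m ^ (a + 1) + 1) ≤ m * m ^ d := Nat.mul_le_mul_left _ h2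
  have h4 : j + m * (σ / m ^ (a + 1)) + 1 ≤ m * m ^ d := by
    rw [Nat.mul_add] at h3; omega
  have h5 := Nat.mul_le_mul_left (m ^ a) h4
  have e2 : m ^ (a + d + 1) = m ^ a * (m * m ^ d) := by ring
  rw [e2]
  rw [Nat.mul_add, Nat.mul_one] at h5
  omega

theorem upd_digit {m σ a j : ℕ} (hm : 1 ≤ m) (hj : j < m) (π : ℕ) :
    upd m σ a j / m ^ π % m = if π = a then j else σ / m ^ π % m := by
  unfold upd
  have hpos : ∀ k, 0 < m ^ k := fun k => Nat.pow_pos hm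
  have h1 : σ % m ^ a < m ^ a := Nat.mod_lt _ (hpos a)
  have hdiv : ∀ X, (σ % m ^ a + m ^ a * X) / m ^ a = X := by
    intro X
    rw [Nat.add_mul_div_left _ _ (hpos a), Nat.div_eq_of_lt h1, Nat.zero_add]
  rcases lt_trichotomy π a with h | rfl | h
  · rw [if_neg h.ne]
    obtain ⟨d, rfl⟩ := Nat.exists_eq_add_of_lt h
    have key : ∀ X, (σ % m ^ (π + d + 1) + m ^ (π + d + 1) * X) / m ^ π % m
        = (σ % m ^ (π + d + 1)) / m ^ π % m := by
      intro X
      rw [show m ^ (π + d + 1) * X = m ^ π * (m * (m ^ d * X)) by ring,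
        Nat.add_mul_div_left _ _ (hpos π), Nat.add_mul_mod_self_left]
    rw [key]
    conv_rhs => rw [← Nat.mod_add_div σ (m ^ (π + d + 1))]
    rw [key]
  · rw [if_pos rfl, hdiv, Nat.add_mul_mod_self_left, Nat.mod_eq_of_lt hj]
  · rw [if_neg h.ne']
    obtain ⟨d, rfl⟩ := Nat.exists_eq_add_of_lt h
    have e : m ^ (a + d + 1) = m ^ a * (m * m ^ d) := by ring
    rw [e, ← Nat.div_div_eq_div_mul, hdiv, ← Nat.div_div_eq_div_mul,
      Nat.add_mul_div_left _ _ hm, Nat.div_eq_of_lt hj, Nat.zero_add, pow_succ,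
      ← Nat.div_div_eq_div_mul, ← Nat.div_div_eq_div_mul, ← Nat.div_div_eq_div_mul]

theorem asg_upd (t : ℕ → Trace) {m σ a j : ℕ} (hm : 1 ≤ m) (hj : j < m) :
    asg t m (upd m σ a j) = Function.update (asg t m σ) a (t j) := by
  funext π
  simp only [asg, upd_digit hm hj, Function.update_apply]
  split_ifs <;> rfl

/-- Successor position in the lasso. -/
def nxt (N p i : ℕ) : ℕ := if i + 1 < N then i + 1 else p

/-- The local conditions on a truth table `V` (code, assignment, position). -/
def Loc (m N p : ℕ) (V : ℕ → ℕ → ℕ → Prop) (c σ i : ℕ) : Prop :=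
  (c % 8 = 0 → V c σ i) ∧
  (c % 8 = 1 → (V c σ i ↔
    V (8 * Nat.pair (c / 8).unpair.1 0 + 1) (σ / m ^ (c / 8).unpair.2 % m) i)) ∧
  (c % 8 = 2 → (V c σ i ↔ ¬ V (c / 8) σ i)) ∧
  (c % 8 = 3 → (V c σ i ↔ (V (c / 8).unpair.1 σ i ∨ V (c / 8).unpair.2 σ i))) ∧
  (c % 8 = 4 → (V c σ i ↔ V (c / 8) σ (nxt N p i))) ∧
  (c % 8 = 5 → (V c σ i ↔
    (V (c / 8).unpair.2 σ i ∨ (V (c / 8).unpair.1 σ i ∧ V c σ (nxt N p i))))) ∧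
  (c % 8 = 5 → V c σ p → ∃ j < N, p ≤ j ∧ V (c / 8).unpair.2 σ j) ∧
  (c % 8 = 6 → i = 0 → (V c σ i ↔
    ∃ j < m, V (c / 8).unpair.2 (upd m σ (c / 8).unpair.1 j) i)) ∧
  (c % 8 = 7 → i = 0 → (V c σ i ↔
    ∀ j < m, V (c / 8).unpair.2 (upd m σ (c / 8).unpair.1 j) i))

/-- A certificate for satisfiability of the formula with code `n`. -/
def Cert (m n N p : ℕ) (V : ℕ → ℕ → ℕ → Prop) : Prop :=
  V n 0 0 ∧ p < N ∧ ∀ c < n + 1, ∀ σ < m ^ (n + 1), ∀ i < N, Loc m N p V c σ i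

/-- Unrolling of the lasso. -/
def unroll (N p : ℕ) : ℕ → ℕ
  | 0 => 0
  | k + 1 => nxt N p (unroll N p k)

theorem unroll_lt {N p : ℕ} (h : p < N) (k : ℕ) : unroll N p k < N := by
  induction k with
  | zero => simp only [unroll]; omega
  | succ k ih => simp only [unroll, nxt]; split_ifs <;> omega

theorem unroll_add {N p k d : ℕ} (h : unroll N p k + d < N) :
    unroll N p (k + d) = unroll N p k + d := by
  induction d with
  | zero => rfl
  | succ d ih =>
    have := ih (by omega)
    rw [← Nat.add_assoc, unroll, this, nxt, if_pos (by omega)]; omega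

theorem unroll_hits {N p : ℕ} (h : p < N) (k : ℕ) : ∃ k', k ≤ k' ∧ unroll N p k' = p := by
  have hk := unroll_lt h k
  have h1 : unroll N p (k + (N - 1 - unroll N p k)) = N - 1 := by
    rw [unroll_add (by omega)]; omega
  refine ⟨k + (N - 1 - unroll N p k) + 1, by omega, ?_⟩
  rw [unroll, h1, nxt, if_neg (by omega)]

theorem shift_shift (A : ℕ → Trace) (i j : ℕ) :
    HLTL.shift (HLTL.shift A i) j = HLTL.shift A (i + j) := by
  funext π k
  simp only [HLTL.shift]; congr 1; omega

theorem shift_zero (A : ℕ → Trace) : HLTL.shift A 0 = A := rfl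

/-- The traces read off from a truth table. -/
def trs (V : ℕ → ℕ → ℕ → Prop) (N p : ℕ) : ℕ → Trace :=
  fun j k => {a | V (8 * Nat.pair a 0 + 1) j (unroll N p k)}

theorem until_sound {V1 V2 V3 : ℕ → Prop} {N p : ℕ} (hp : p < N)
    (h1 : ∀ i < N, (V3 i ↔ (V2 i ∨ (V1 i ∧ V3 (nxt N p i)))))
    (h2 : V3 p → ∃ j < N, p ≤ j ∧ V2 j) (k : ℕ) :
    (∃ i, V2 (unroll N p (k + i)) ∧ ∀ j < i, V1 (unroll N p (k + j))) ↔ V3 (unroll N p k) := by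
  constructor
  · rintro ⟨i, hi, hj⟩
    induction i generalizing k with
    | zero => exact (h1 _ (unroll_lt hp k)).2 (Or.inl hi)
    | succ i ih =>
      refine (h1 _ (unroll_lt hp k)).2 (Or.inr ⟨hj 0 (by omega), ?_⟩)
      refine ih (k + 1) ?_ ?_
      · rwa [show k + 1 + i = k + (i + 1) by omega]
      · intro j hji
        have := hj (j + 1) (by omega)
        rwa [show k + 1 + j = k + (j + 1) by omega]
  · intro h3
    by_contra hcon
    have hall : ∀ d, V3 (unroll N p (k + d)) ∧ ∀ j < d, V1 (unroll N p (k + j)) := by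
      intro d
      induction d with
      | zero => exact ⟨h3, fun j hj => absurd hj (by omega)⟩
      | succ d ih =>
        have hn2 : ¬ V2 (unroll N p (k + d)) := fun h => hcon ⟨d, h, ih.2⟩
        rcases (h1 _ (unroll_lt hp (k + d))).1 ih.1 with h | ⟨ha, hb⟩
        · exact absurd h hn2
        · refine ⟨hb, fun j hj => ?_⟩
          rcases Nat.lt_succ_iff_lt_or_eq.1 hj with h | rfl
          · exact ih.2 j h
          · exact ha
    obtain ⟨k', hk, hk'⟩ := unroll_hits hp k
    obtain ⟨d, rfl⟩ := Nat.exists_eq_add_of_le hk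
    obtain ⟨j, hjN, hpj, hj⟩ := h2 (by rw [← hk']; exact (hall d).1)
    refine hcon ⟨d + (j - p), ?_, (hall _).2⟩
    rw [← Nat.add_assoc, unroll_add (by rw [hk']; omega), hk', show p + (j - p) = j by omega]
    exact hj

theorem qf_sound {m n N p : ℕ} {V : ℕ → ℕ → ℕ → Prop} (hC : Cert m n N p V)
    (T : Set Trace) (φ : HLTL) : φ.quantFree = true → φ.encode ≤ n → ∀ σ < m ^ (n + 1), ∀ k,
    (HLTL.sat T φ (HLTL.shift (asg (trs V N p) m σ) k) ↔ V φ.encode σ (unroll N p k)) := by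
  obtain ⟨-, hp, hL⟩ := hC
  induction φ with
  | tt =>
    intro _ hn σ hσ k
    have := hL 0 (by omega) σ hσ _ (unroll_lt hp k)
    simp only [HLTL.sat, HLTL.encode, true_iff]
    exact this.1 rfl
  | atom a π =>
    intro _ hn σ hσ k
    have := hL _ (Nat.lt_succ_of_le hn) σ hσ _ (unroll_lt hp k)
    have := this.2.1 (by simp only [HLTL.encode]; omega)
    rw [this]
    simp only [HLTL.encode, HLTL.sat,
      show (8 * Nat.pair a π + 1) / 8 = Nat.pair a π by omega, Nat.unpair_pair]
    simp [HLTL.shift, asg, trs]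
  | neg φ ih =>
    intro hq hn σ hσ k
    have := hL _ (Nat.lt_succ_of_le hn) σ hσ _ (unroll_lt hp k)
    have := this.2.2.1 (by simp only [HLTL.encode]; omega)
    rw [this]
    simp only [HLTL.encode] at hn ⊢
    rw [show (8 * φ.encode + 2) / 8 = φ.encode by omega]
    exact not_congr (ih hq (by omega) σ hσ k)
  | or φ ψ ih1 ih2 =>
    intro hq hn σ hσ k
    have := hL _ (Nat.lt_succ_of_le hn) σ hσ _ (unroll_lt hp k)
    have := this.2.2.2.1 (by simp only [HLTL.encode]; omega)
    rw [this]
    simp only [HLTL.encode, HLTL.quantFree, Bool.and_eq_true] at hn hq ⊢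
    have e1 := Nat.left_le_pair φ.encode ψ.encode
    have e2 := Nat.right_le_pair φ.encode ψ.encode
    rw [show (8 * Nat.pair φ.encode ψ.encode + 3) / 8 = Nat.pair φ.encode ψ.encode by omega,
      Nat.unpair_pair]
    exact or_congr (ih1 hq.1 (by omega) σ hσ k) (ih2 hq.2 (by omega) σ hσ k)
  | next φ ih =>
    intro hq hn σ hσ k
    have := hL _ (Nat.lt_succ_of_le hn) σ hσ _ (unroll_lt hp k)
    have := this.2.2.2.2.1 (by simp only [HLTL.encode]; omega)
    rw [this]
    simp only [HLTL.encode] at hn ⊢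
    rw [show (8 * φ.encode + 4) / 8 = φ.encode by omega]
    simp only [HLTL.sat, shift_shift]
    exact ih hq (by omega) σ hσ (k + 1)
  | until_ φ ψ ih1 ih2 =>
    intro hq hn σ hσ k
    have e1 := Nat.left_le_pair φ.encode ψ.encode
    have e2 := Nat.right_le_pair φ.encode ψ.encode
    have ed : (8 * Nat.pair φ.encode ψ.encode + 5) / 8 = Nat.pair φ.encode ψ.encode := by omega
    have h1 : ∀ i < N, _ := fun i hi =>
      (hL _ (Nat.lt_succ_of_le hn) σ hσ i hi).2.2.2.2.2.1 (by simp only [HLTL.encode]; omega)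
    have h2 := (hL _ (Nat.lt_succ_of_le hn) σ hσ p hp).2.2.2.2.2.2.1
      (by simp only [HLTL.encode]; omega)
    simp only [HLTL.encode, HLTL.quantFree, Bool.and_eq_true, ed, Nat.unpair_pair]
      at hn hq h1 h2 ⊢
    rw [← until_sound hp h1 h2 k]
    simp only [HLTL.sat, shift_shift]
    simp only [ih1 hq.1 (by omega) σ hσ, ih2 hq.2 (by omega) σ hσ]
  | ex π φ ih => intro h; simp [HLTL.quantFree] at h
  | all π φ ih => intro h; simp [HLTL.quantFree] at h

theorem prenex_sound {m n N p : ℕ} {V : ℕ → ℕ → ℕ → Prop} (hm : 1 ≤ m) (hC : Cert m n N p V)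
    (φ : HLTL) : φ.prenex = true → φ.encode ≤ n → ∀ σ < m ^ (n + 1),
    (HLTL.sat (trs V N p '' Set.Iio m) φ (asg (trs V N p) m σ) ↔ V φ.encode σ 0) := by
  induction φ with
  | ex π φ ih =>
    intro hq hn σ hσ
    have := hC.2.2 _ (Nat.lt_succ_of_le hn) σ hσ 0 (by have := hC.2.1; omega)
    have := this.2.2.2.2.2.2.2.1 (by simp only [HLTL.encode]; omega) rfl
    rw [this]
    have e1 := Nat.left_le_pair π φ.encode
    have e2 := Nat.right_le_pair π φ.encode
    simp only [HLTL.encode, HLTL.prenex] at hn hq ⊢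
    rw [show (8 * Nat.pair π φ.encode + 6) / 8 = Nat.pair π φ.encode by omega, Nat.unpair_pair]
    simp only [HLTL.sat, Set.exists_mem_image, Set.mem_Iio]
    refine exists_congr fun j => and_congr_right fun hj => ?_
    rw [← asg_upd _ hm hj]
    exact ih hq (by omega) _ (upd_lt hm hσ (by omega) hj)
  | all π φ ih =>
    intro hq hn σ hσ
    have := hC.2.2 _ (Nat.lt_succ_of_le hn) σ hσ 0 (by have := hC.2.1; omega)
    have := this.2.2.2.2.2.2.2.2 (by simp only [HLTL.encode]; omega) rfl
    rw [this]
    have e1 := Nat.left_le_pair π φ.encode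
    have e2 := Nat.right_le_pair π φ.encode
    simp only [HLTL.encode, HLTL.prenex] at hn hq ⊢
    rw [show (8 * Nat.pair π φ.encode + 7) / 8 = Nat.pair π φ.encode by omega, Nat.unpair_pair]
    simp only [HLTL.sat, Set.forall_mem_image, Set.mem_Iio]
    refine forall_congr' fun j => forall_congr' fun hj => ?_
    rw [← asg_upd _ hm hj]
    exact ih hq (by omega) _ (upd_lt hm hσ (by omega) hj)
  | _ => exact fun hq hn σ hσ => qf_sound hC _ _ hq hn σ hσ 0

theorem cert_sound {m n N p : ℕ} {V : ℕ → ℕ → ℕ → Prop} (hm : 1 ≤ m) (hC : Cert m n N p V)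
    {ψ : HLTL} (hS : ψ.Sentence) (he : ψ.encode = n) :
    ∃ T : Set Trace, T.Finite ∧ T.ncard ≤ m ∧ HLTL.SatBy T ψ := by
  have hfin : (Set.Iio m).Finite := Set.finite_Iio m
  refine ⟨trs V N p '' Set.Iio m, hfin.image _, ?_, ?_, fun A => ?_⟩
  · refine (Set.ncard_image_le hfin).trans ?_
    rw [← Finset.coe_Iio, Set.ncard_coe_finset]; simp
  · exact ⟨_, 0, hm, rfl⟩
  · rw [sat_congr _ ψ A (asg (trs V N p) m 0) (by rw [hS.2]; simp)]
    rw [prenex_sound hm hC ψ hS.1 he.le 0 (Nat.pow_pos hm), he]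
    exact hC.1

/-! ### Completeness -/

/-- Truth of the formula with code `c` at position `i`. -/
def Vt (T : Set Trace) (t : ℕ → Trace) (m c σ i : ℕ) : Prop :=
  HLTL.sat T (dec c) (HLTL.shift (asg t m σ) i)

/-- Bound on the size of the lasso. -/
def bnd (m n : ℕ) : ℕ :=
  2 ^ ((n + 1) * m ^ (n + 1)) * 2 * 2 ^ ((n + 1) * m ^ (n + 1))

theorem Vt_until (T : Set Trace) (t : ℕ → Trace) (m c σ i : ℕ) (hc : c % 8 = 5) :
    Vt T t m c σ i ↔ ∃ j, Vt T t m (c / 8).unpair.2 σ (i + j) ∧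
      ∀ k < j, Vt T t m (c / 8).unpair.1 σ (i + k) := by
  simp only [Vt, dec5 hc, HLTL.sat, shift_shift]

theorem Vt_until_step (T : Set Trace) (t : ℕ → Trace) (m c σ i : ℕ) (hc : c % 8 = 5) :
    Vt T t m c σ i ↔ (Vt T t m (c / 8).unpair.2 σ i ∨
      (Vt T t m (c / 8).unpair.1 σ i ∧ Vt T t m c σ (i + 1))) := by
  rw [Vt_until T t m c σ i hc, Vt_until T t m c σ (i + 1) hc]
  constructor
  · rintro ⟨j, hj, hk⟩
    cases j with
    | zero => exact Or.inl hj
    | succ j =>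
      refine Or.inr ⟨hk 0 (by omega), j, ?_, fun k hkj => ?_⟩
      · rwa [show i + 1 + j = i + (j + 1) by omega]
      · rw [show i + 1 + k = i + (k + 1) by omega]; exact hk _ (by omega)
  · rintro (h | ⟨h1, j, hj, hk⟩)
    · exact ⟨0, h, fun k hk => absurd hk (by omega)⟩
    · refine ⟨j + 1, ?_, fun k hkj => ?_⟩
      · rwa [show i + (j + 1) = i + 1 + j by omega]
      · cases k with
        | zero => exact h1
        | succ k => rw [show i + (k + 1) = i + 1 + k by omega]; exact hk _ (by omega)

theorem cert_complete {m n : ℕ} (hm : 1 ≤ m) (t : ℕ → Trace)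
    (hsat : HLTL.sat (t '' Set.Iio m) (dec n) (asg t m 0)) :
    ∃ N ≤ bnd m n, ∃ p < N, ∃ V₀ : ℕ → ℕ → ℕ → Prop, ∀ V : ℕ → ℕ → ℕ → Prop,
      (∀ c ≤ n, ∀ σ < m ^ (n + 1), ∀ i < N, (V c σ i ↔ V₀ c σ i)) → Cert m n N p V := by
  classical
  set T := t '' Set.Iio m with hT
  let S := m ^ (n + 1)
  have hS : 0 < S := Nat.pow_pos hm
  have hmS : m ≤ S := Nat.le_self_pow (by omega) m
  let τ : ℕ → Set (Fin (n + 1) × Fin S) := fun i => {x | Vt T t m x.1 x.2 i}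
  let req : Fin (n + 1) × Fin S → Set (Fin (n + 1) × Fin S) → Prop :=
    fun u γ => u.1.1 % 8 = 5 ∧ u ∈ γ
  let ful : Fin (n + 1) × Fin S → Set (Fin (n + 1) × Fin S) → Prop :=
    fun u γ => ∃ x ∈ γ, x.1.1 = (u.1.1 / 8).unpair.2 ∧ x.2 = u.2
  have hreq : ∀ u i, req u (τ i) → ∃ j, i ≤ j ∧ ful u (τ j) := by
    rintro ⟨⟨c, hc⟩, σ⟩ i ⟨h5, hu⟩
    obtain ⟨j, hj, -⟩ := (Vt_until T t m c σ i h5).1 hu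
    have := Nat.unpair_right_le (c / 8)
    exact ⟨i + j, by omega, (⟨(c / 8).unpair.2, by omega⟩, σ), hj, rfl, rfl⟩
  obtain ⟨f, p, N, hN, hp, h0, hs, hl, hf⟩ := lasso_bounded τ req ful hreq
  have tr : ∀ {a b}, τ a = τ b → ∀ c ≤ n, ∀ σ < S, (Vt T t m c σ a ↔ Vt T t m c σ b) := by
    intro a b hab c hc σ hσ
    exact Set.ext_iff.1 hab (⟨c, by omega⟩, ⟨σ, hσ⟩)
  have hnx : ∀ i < N, τ (f (nxt N p i)) = τ (f i + 1) := by
    intro i hi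
    unfold nxt
    split_ifs with h
    · exact hs i h
    · rw [hl, show N - 1 = i by omega]
  have hnlt : ∀ i, nxt N p i < N := by
    intro i; unfold nxt; split_ifs <;> omega
  refine ⟨N, ?_, p, hp, fun c σ i => Vt T t m c σ (f i), fun V hV => ?_⟩
  · simpa [bnd] using hN
  beta_reduce at hV
  refine ⟨?_, hp, ?_⟩
  · rw [hV n le_rfl 0 hS 0 (by omega), tr h0 n le_rfl 0 hS]
    exact hsat
  · intro c hc σ hσ i hi
    have hc' : c ≤ n := by omega
    have hu1 := Nat.unpair_left_le (c / 8)
    have hu2 := Nat.unpair_right_le (c / 8)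
    have b0 : c / 8 ≤ n := by omega
    have b1 : (c / 8).unpair.1 ≤ n := by omega
    have b2 : (c / 8).unpair.2 ≤ n := by omega
    refine ⟨?_, ?_, ?_, ?_, ?_, ?_, ?_, ?_, ?_⟩
    · intro h
      rw [hV c hc' σ hσ i hi, Vt, dec0 h]
      trivial
    · intro h
      have hle : 8 * Nat.pair (c / 8).unpair.1 0 + 1 ≤ c := by
        have h1 : Nat.pair (c / 8).unpair.1 0 ≤ Nat.pair (c / 8).unpair.1 (c / 8).unpair.2 := by
          rcases Nat.eq_zero_or_pos (c / 8).unpair.2 with h | h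
          · rw [h]
          · exact (Nat.pair_lt_pair_right _ h).le
        rw [Nat.pair_unpair] at h1
        omega
      have hd : σ / m ^ (c / 8).unpair.2 % m < m := Nat.mod_lt _ hm
      rw [hV c hc' σ hσ i hi, hV _ (hle.trans hc') _ (hd.trans_le hmS) i hi, Vt, Vt, dec1 h,
        dec1 (show (8 * Nat.pair (c / 8).unpair.1 0 + 1) % 8 = 1 by omega),
        show (8 * Nat.pair (c / 8).unpair.1 0 + 1) / 8 = Nat.pair (c / 8).unpair.1 0 by omega,
        Nat.unpair_pair]
      simp only [HLTL.sat, HLTL.shift, asg, pow_zero, Nat.div_one, Nat.mod_mod]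
    · intro h
      rw [hV c hc' σ hσ i hi, hV _ b0 σ hσ i hi, Vt, Vt, dec2 h]
      rfl
    · intro h
      rw [hV c hc' σ hσ i hi, hV _ b1 σ hσ i hi, hV _ b2 σ hσ i hi, Vt, dec3 h]
      rfl
    · intro h
      rw [hV c hc' σ hσ i hi, hV _ b0 σ hσ _ (hnlt i), tr (hnx i hi) _ b0 σ hσ, Vt, Vt, dec4 h]
      simp only [HLTL.sat, shift_shift]
    · intro h
      rw [hV c hc' σ hσ i hi, hV _ b1 σ hσ i hi, hV _ b2 σ hσ i hi, hV c hc' σ hσ _ (hnlt i),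
        tr (hnx i hi) _ hc' σ hσ]
      exact Vt_until_step T t m c σ (f i) h
    · intro h hVp
      rw [hV c hc' σ hσ p hp] at hVp
      obtain ⟨j, hj1, hj2, ⟨⟨x, hx⟩, y⟩, hxy, hx1, hx2⟩ := hf (⟨c, hc⟩, ⟨σ, hσ⟩) ⟨h, hVp⟩
      refine ⟨j, hj2, hj1, ?_⟩
      simp only at hx1 hx2
      subst hx1 hx2
      exact (hV _ b2 σ hσ j hj2).2 hxy
    · rintro h rfl
      rw [hV c hc' σ hσ 0 hi, tr h0 _ hc' σ hσ, Vt, dec6 h]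
      simp only [HLTL.sat, hT, Set.exists_mem_image, Set.mem_Iio, shift_zero]
      refine exists_congr fun j => and_congr_right fun hj => ?_
      have hlt := upd_lt hm hσ b1 hj
      rw [← asg_upd t hm hj, hV _ b2 _ hlt 0 hi, tr h0 _ b2 _ hlt]
      rfl
    · rintro h rfl
      rw [hV c hc' σ hσ 0 hi, tr h0 _ hc' σ hσ, Vt, dec7 h]
      simp only [HLTL.sat, hT, Set.forall_mem_image, Set.mem_Iio, shift_zero]
      refine forall_congr' fun j => forall_congr' fun hj => ?_
      have hlt := upd_lt hm hσ b1 hj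
      rw [← asg_upd t hm hj, hV _ b2 _ hlt 0 hi, tr h0 _ b2 _ hlt]
      rfl

/-- A nonempty finite set with at most `m` elements is enumerated by `0, …, m - 1`. -/
theorem exists_enum {α : Type} {T : Set α} {m : ℕ} (hf : T.Finite) (hc : T.ncard ≤ m)
    (hne : T.Nonempty) : ∃ t : ℕ → α, T = t '' Set.Iio m := by
  classical
  obtain ⟨x₀, hx₀⟩ := hne
  have hmpos : 0 < m := lt_of_lt_of_le ((Set.ncard_pos hf).2 ⟨x₀, hx₀⟩) hc
  let L := hf.toFinset.toList
  have hlen : L.length ≤ m := by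
    rw [Set.ncard_eq_toFinset_card T hf] at hc
    simpa [L] using hc
  have hL : ∀ x, x ∈ L ↔ x ∈ T := by simp [L]
  refine ⟨fun i => L.getD i x₀, ?_⟩
  ext x
  simp only [Set.mem_image, Set.mem_Iio]
  constructor
  · intro hx
    obtain ⟨i, hi, rfl⟩ := List.mem_iff_getElem.1 ((hL x).2 hx)
    exact ⟨i, by omega, by simp [List.getD_eq_getElem?_getD, hi]⟩
  · rintro ⟨i, -, rfl⟩
    by_cases hi : i < L.length
    · rw [List.getD_eq_getElem _ _ hi]
      exact (hL _).1 (List.getElem_mem hi)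
    · rw [List.getD_eq_default _ _ (by omega)]; exact hx₀

/-! ### Truth tables as numbers -/

/-- Bit of a table coded as a number. -/
def Bit (W c σ i : ℕ) : Prop := W / 2 ^ (Nat.pair c (Nat.pair σ i)) % 2 = 1

theorem pair_mono {a b c d : ℕ} (h1 : a ≤ c) (h2 : b ≤ d) : Nat.pair a b ≤ Nat.pair c d := by
  have e1 : Nat.pair a b ≤ Nat.pair c b := by
    rcases h1.lt_or_eq with h | rfl
    · exact (Nat.pair_lt_pair_left _ h).le
    · exact le_rfl
  have e2 : Nat.pair c b ≤ Nat.pair c d := by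
    rcases h2.lt_or_eq with h | rfl
    · exact (Nat.pair_lt_pair_right _ h).le
    · exact le_rfl
  exact e1.trans e2

/-- Bound for the code of a table. -/
def tbl (m n : ℕ) : ℕ := 2 ^ (Nat.pair n (Nat.pair (m ^ (n + 1)) (bnd m n)) + 1)

theorem exists_table (m n N : ℕ) (hN : N ≤ bnd m n) (V₀ : ℕ → ℕ → ℕ → Prop) :
    ∃ W < tbl m n, ∀ c ≤ n, ∀ σ < m ^ (n + 1), ∀ i < N, (Bit W c σ i ↔ V₀ c σ i) := by
  classical
  let g : Fin (Nat.pair n (Nat.pair (m ^ (n + 1)) (bnd m n)) + 1) → Bool := fun k =>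
    decide (V₀ k.1.unpair.1 k.1.unpair.2.unpair.1 k.1.unpair.2.unpair.2)
  refine ⟨Nat.ofBits g, Nat.ofBits_lt_two_pow g, ?_⟩
  intro c hc σ hσ i hi
  have hlt : Nat.pair c (Nat.pair σ i) < Nat.pair n (Nat.pair (m ^ (n + 1)) (bnd m n)) + 1 :=
    Nat.lt_succ_of_le (pair_mono hc (pair_mono hσ.le (hi.le.trans hN)))
  have h := Nat.testBit_ofBits_lt g _ hlt
  rw [Nat.testBit_eq_decide_div_mod_eq] at h
  unfold Bit
  simp only [g, Nat.unpair_pair, decide_eq_decide] at h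
  exact h

theorem main_iff {m : ℕ} (hm : 1 ≤ m) (n : ℕ) :
    (∃ ψ : HLTL, HLTL.Sentence ψ ∧ HLTL.encode ψ = n ∧
        ∃ T : Set Trace, T.Finite ∧ T.ncard ≤ m ∧ HLTL.SatBy T ψ) ↔
    ((dec n).encode = n ∧ (dec n).prenex = true ∧ (∀ π < n + 1, ¬ π ∈ (dec n).free) ∧
      ∃ N < bnd m n + 1, ∃ p < N, ∃ W < tbl m n, Cert m n N p (Bit W)) := by
  constructor
  · rintro ⟨ψ, hS, rfl, T, hf, hc, hne, hsat⟩
    rw [dec_encode]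
    refine ⟨rfl, hS.1, by simp [hS.2], ?_⟩
    obtain ⟨t, rfl⟩ := exists_enum hf hc hne
    obtain ⟨N, hN, p, hp, V₀, hV⟩ := cert_complete (n := ψ.encode) hm t
      (by rw [dec_encode]; exact hsat _)
    obtain ⟨W, hW, hWV⟩ := exists_table m ψ.encode N hN V₀
    exact ⟨N, by omega, p, hp, W, hW, hV _ hWV⟩
  · rintro ⟨he, hpr, hfr, N, -, p, -, W, -, hC⟩
    have hS : (dec n).Sentence := by
      refine ⟨hpr, Finset.eq_empty_of_forall_notMem fun π hπ => ?_⟩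
      have := free_le_encode _ π hπ
      exact hfr π (by omega) hπ
    exact ⟨dec n, hS, he, cert_sound hm hC hS he⟩

/-! ### Computability -/

section Comp

variable {α : Type} [Primcodable α]

theorem pr_imp {p q : α → Prop} (hp : PrimrecPred p) (hq : PrimrecPred q) :
    PrimrecPred fun a => p a → q a :=
  (hp.not.or hq).of_eq fun _ => imp_iff_not_or.symm

theorem pr_iff {p q : α → Prop} (hp : PrimrecPred p) (hq : PrimrecPred q) :
    PrimrecPred fun a => p a ↔ q a :=
  ((pr_imp hp hq).and (pr_imp hq hp)).of_eq fun _ => iff_iff_implies_and_implies.symm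

theorem pr_all {f : α → ℕ} {R : α → ℕ → Prop} (hf : Primrec f)
    (hR : PrimrecPred fun x : α × ℕ => R x.1 x.2) : PrimrecPred fun a => ∀ x < f a, R a x :=
  have h : PrimrecRel fun (x : ℕ) (a : α) => R a x :=
    hR.comp (Primrec.pair Primrec.snd Primrec.fst)
  (h.forall_mem_list.comp (Primrec.list_range.comp hf) Primrec.id).of_eq (by simp)

theorem pr_ex {f : α → ℕ} {R : α → ℕ → Prop} (hf : Primrec f)
    (hR : PrimrecPred fun x : α × ℕ => R x.1 x.2) : PrimrecPred fun a => ∃ x < f a, R a x :=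
  have h : PrimrecRel fun (x : ℕ) (a : α) => R a x :=
    hR.comp (Primrec.pair Primrec.snd Primrec.fst)
  (h.exists_mem_list.comp (Primrec.list_range.comp hf) Primrec.id).of_eq (by simp)

theorem pr_pow {f g : α → ℕ} (hf : Primrec f) (hg : Primrec g) :
    Primrec fun a => f a ^ g a :=
  have h : Primrec₂ ((· ^ ·) : ℕ → ℕ → ℕ) := Primrec₂.unpaired'.1 Nat.Primrec.pow
  h.comp hf hg

theorem pr_pair {f g : α → ℕ} (hf : Primrec f) (hg : Primrec g) :
    Primrec fun a => Nat.pair (f a) (g a) := Primrec₂.natPair.comp hf hg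

theorem pr_add {f g : α → ℕ} (hf : Primrec f) (hg : Primrec g) :
    Primrec fun a => f a + g a := Primrec.nat_add.comp hf hg

theorem pr_mul {f g : α → ℕ} (hf : Primrec f) (hg : Primrec g) :
    Primrec fun a => f a * g a := Primrec.nat_mul.comp hf hg

theorem pr_div {f g : α → ℕ} (hf : Primrec f) (hg : Primrec g) :
    Primrec fun a => f a / g a := Primrec.nat_div.comp hf hg

theorem pr_mod {f g : α → ℕ} (hf : Primrec f) (hg : Primrec g) :
    Primrec fun a => f a % g a := Primrec.nat_mod.comp hf hg

theorem pr_u1 {f : α → ℕ} (hf : Primrec f) : Primrec fun a => (f a / 8).unpair.1 :=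
  Primrec.fst.comp (Primrec.unpair.comp (pr_div hf (Primrec.const 8)))

theorem pr_u2 {f : α → ℕ} (hf : Primrec f) : Primrec fun a => (f a / 8).unpair.2 :=
  Primrec.snd.comp (Primrec.unpair.comp (pr_div hf (Primrec.const 8)))

theorem pr_md {f : α → ℕ} (hf : Primrec f) (k : ℕ) : PrimrecPred fun a => f a % 8 = k :=
  Primrec.eq.comp (pr_mod hf (Primrec.const 8)) (Primrec.const k)

theorem pr_upd {f g h : α → ℕ} (m : ℕ) (hf : Primrec f) (hg : Primrec g) (hh : Primrec h) :
    Primrec fun a => upd m (f a) (g a) (h a) :=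
  have c := Primrec.const (α := α) m
  pr_add (pr_mod hf (pr_pow c hg)) (pr_mul (pr_pow c hg)
    (pr_add hh (pr_mul c (pr_div hf (pr_pow c (pr_add hg (Primrec.const 1)))))))

theorem pr_nxt {f g h : α → ℕ} (hf : Primrec f) (hg : Primrec g) (hh : Primrec h) :
    Primrec fun a => nxt (f a) (g a) (h a) :=
  Primrec.ite (Primrec.nat_lt.comp (pr_add hh (Primrec.const 1)) hf)
    (pr_add hh (Primrec.const 1)) hg

theorem pr_bit {W c s i : α → ℕ} (hW : Primrec W) (hc : Primrec c) (hs : Primrec s)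
    (hi : Primrec i) : PrimrecPred fun a => Bit (W a) (c a) (s a) (i a) :=
  Primrec.eq.comp (pr_mod (pr_div hW (pr_pow (Primrec.const 2) (pr_pair hc (pr_pair hs hi))))
    (Primrec.const 2)) (Primrec.const 1)

theorem pr_loc {N p W c s i : α → ℕ} (m : ℕ) (hN : Primrec N) (hp : Primrec p) (hW : Primrec W)
    (hc : Primrec c) (hs : Primrec s) (hi : Primrec i) :
    PrimrecPred fun a => Loc m (N a) (p a) (Bit (W a)) (c a) (s a) (i a) := by
  have f1 : Primrec (Prod.fst : α × ℕ → α) := Primrec.fst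
  have f2 : Primrec (Prod.snd : α × ℕ → ℕ) := Primrec.snd
  have h8 : Primrec fun a => c a / 8 := pr_div hc (Primrec.const 8)
  have k0 : PrimrecPred fun a => i a = 0 := Primrec.eq.comp hi (Primrec.const 0)
  have hx := pr_nxt hN hp hi
  have b := pr_bit hW hc hs hi
  have hq := pr_bit (hW.comp f1) ((pr_u2 hc).comp f1)
    (pr_upd m (hs.comp f1) ((pr_u1 hc).comp f1) f2) (hi.comp f1)
  refine (pr_imp (pr_md hc 0) b).and <| .and ?_ <| .and ?_ <| .and ?_ <| .and ?_ <| .and ?_ <|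
    .and ?_ <| .and ?_ ?_
  · exact pr_imp (pr_md hc 1) (pr_iff b (pr_bit hW
      (pr_add (pr_mul (Primrec.const 8) (pr_pair (pr_u1 hc) (Primrec.const 0))) (Primrec.const 1))
      (pr_mod (pr_div hs (pr_pow (Primrec.const m) (pr_u2 hc))) (Primrec.const m)) hi))
  · exact pr_imp (pr_md hc 2) (pr_iff b (pr_bit hW h8 hs hi).not)
  · exact pr_imp (pr_md hc 3) (pr_iff b
      ((pr_bit hW (pr_u1 hc) hs hi).or (pr_bit hW (pr_u2 hc) hs hi)))
  · exact pr_imp (pr_md hc 4) (pr_iff b (pr_bit hW h8 hs hx))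
  · exact pr_imp (pr_md hc 5) (pr_iff b ((pr_bit hW (pr_u2 hc) hs hi).or
      ((pr_bit hW (pr_u1 hc) hs hi).and (pr_bit hW hc hs hx))))
  · exact pr_imp (pr_md hc 5) (pr_imp (pr_bit hW hc hs hp) (pr_ex hN
      ((Primrec.nat_le.comp (hp.comp f1) f2).and
        (pr_bit (hW.comp f1) ((pr_u2 hc).comp f1) (hs.comp f1) f2))))
  · exact pr_imp (pr_md hc 6) (pr_imp k0 (pr_iff b (pr_ex (Primrec.const m) hq)))
  · exact pr_imp (pr_md hc 7) (pr_imp k0 (pr_iff b (pr_all (Primrec.const m) hq)))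

theorem pr_cert {n N p W : α → ℕ} (m : ℕ) (hn : Primrec n) (hN : Primrec N) (hp : Primrec p)
    (hW : Primrec W) : PrimrecPred fun a => Cert m (n a) (N a) (p a) (Bit (W a)) := by
  have hn1 := pr_add hn (Primrec.const 1)
  refine (pr_bit hW hn (Primrec.const 0) (Primrec.const 0)).and <|
    (Primrec.nat_lt.comp hp hN).and <| pr_all hn1 <|
    pr_all ((pr_pow (Primrec.const m) hn1).comp Primrec.fst) <|
    pr_all (hN.comp (Primrec.fst.comp Primrec.fst)) ?_
  have f3 : Primrec fun x : ((α × ℕ) × ℕ) × ℕ => x.1.1.1 :=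
    Primrec.fst.comp (Primrec.fst.comp Primrec.fst)
  exact pr_loc m (hN.comp f3) (hp.comp f3) (hW.comp f3)
    (Primrec.snd.comp (Primrec.fst.comp Primrec.fst)) (Primrec.snd.comp Primrec.fst) Primrec.snd

theorem pr_bnd (m : ℕ) : Primrec (bnd m) :=
  have hn1 := pr_add Primrec.id (Primrec.const (α := ℕ) 1)
  have e := pr_pow (Primrec.const 2) (pr_mul hn1 (pr_pow (Primrec.const m) hn1))
  pr_mul (pr_mul e (Primrec.const 2)) e

theorem pr_tbl (m : ℕ) : Primrec (tbl m) :=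
  have hn1 := pr_add Primrec.id (Primrec.const (α := ℕ) 1)
  pr_pow (Primrec.const 2) (pr_add (pr_pair Primrec.id
    (pr_pair (pr_pow (Primrec.const m) hn1) (pr_bnd m))) (Primrec.const 1))

/-- Course-of-values recursion along the code structure. -/
theorem pr_rec {β : Type} [Primcodable β] [Inhabited β] (f : α → ℕ → β)
    (G : α → ℕ → β → β → β → β)
    (hG : Primrec fun x : (α × ℕ) × β × β × β => G x.1.1 x.1.2 x.2.1 x.2.2.1 x.2.2.2)
    (h0 : ∀ a x y z, G a 0 x y z = f a 0)
    (h : ∀ a c, f a c = G a c (f a (c / 8)) (f a (c / 8).unpair.1) (f a (c / 8).unpair.2)) :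
    Primrec₂ f := by
  have hlen : Primrec fun x : α × List β => x.2.length := Primrec.list_length.comp Primrec.snd
  refine Primrec.nat_strong_rec f
    (g := fun a L => some (G a L.length (L.getI (L.length / 8))
      (L.getI (L.length / 8).unpair.1) (L.getI (L.length / 8).unpair.2))) ?_ ?_
  · refine Primrec.option_some.comp (hG.comp (Primrec.pair (Primrec.pair Primrec.fst hlen)
      (Primrec.pair ?_ (Primrec.pair ?_ ?_))))
    · exact Primrec.list_getI.comp Primrec.snd (pr_div hlen (Primrec.const 8))
    · exact Primrec.list_getI.comp Primrec.snd (pr_u1 hlen)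
    · exact Primrec.list_getI.comp Primrec.snd (pr_u2 hlen)
  · intro a n
    rcases Nat.eq_zero_or_pos n with rfl | hn
    · simp [h0]
    · have key : ∀ k < n, ((List.range n).map (f a)).getI k = f a k := by
        intro k hk
        rw [List.getI_eq_getElem _ (by simpa using hk)]
        simp
      have h1 := Nat.unpair_left_le (n / 8)
      have h2 := Nat.unpair_right_le (n / 8)
      simp only [List.length_map, List.length_range]
      rw [key _ (by omega), key _ (by omega), key _ (by omega), ← h]

end Comp

theorem mod8 (c : ℕ) : c % 8 = 0 ∨ c % 8 = 1 ∨ c % 8 = 2 ∨ c % 8 = 3 ∨ c % 8 = 4 ∨ c % 8 = 5 ∨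
    c % 8 = 6 ∨ c % 8 = 7 := by omega

theorem pr_enc : Primrec fun c => (dec c).encode := by
  have h : Primrec₂ fun (_ : Unit) c => (dec c).encode := by
    refine pr_rec _ (fun _ c x y z =>
      if c % 8 = 0 then 0 else if c % 8 = 1 then c else if c % 8 = 2 then 8 * x + 2
      else if c % 8 = 3 then 8 * Nat.pair y z + 3 else if c % 8 = 4 then 8 * x + 4
      else if c % 8 = 5 then 8 * Nat.pair y z + 5
      else if c % 8 = 6 then 8 * Nat.pair (c / 8).unpair.1 z + 6
      else 8 * Nat.pair (c / 8).unpair.1 z + 7) ?_ ?_ ?_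
    · have hc : Primrec fun x : (Unit × ℕ) × ℕ × ℕ × ℕ => x.1.2 := Primrec.snd.comp Primrec.fst
      have hx : Primrec fun x : (Unit × ℕ) × ℕ × ℕ × ℕ => x.2.1 := Primrec.fst.comp Primrec.snd
      have hy : Primrec fun x : (Unit × ℕ) × ℕ × ℕ × ℕ => x.2.2.1 :=
        Primrec.fst.comp (Primrec.snd.comp Primrec.snd)
      have hz : Primrec fun x : (Unit × ℕ) × ℕ × ℕ × ℕ => x.2.2.2 :=
        Primrec.snd.comp (Primrec.snd.comp Primrec.snd)
      have lin : ∀ {g : (Unit × ℕ) × ℕ × ℕ × ℕ → ℕ} (_ : Primrec g) (k : ℕ),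
          Primrec fun x => 8 * g x + k := fun hg k =>
        pr_add (pr_mul (Primrec.const 8) hg) (Primrec.const k)
      exact Primrec.ite (pr_md hc 0) (Primrec.const 0) <| Primrec.ite (pr_md hc 1) hc <|
        Primrec.ite (pr_md hc 2) (lin hx 2) <| Primrec.ite (pr_md hc 3) (lin (pr_pair hy hz) 3) <|
        Primrec.ite (pr_md hc 4) (lin hx 4) <| Primrec.ite (pr_md hc 5) (lin (pr_pair hy hz) 5) <|
        Primrec.ite (pr_md hc 6) (lin (pr_pair (pr_u1 hc) hz) 6) (lin (pr_pair (pr_u1 hc) hz) 7)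
    · intro a x y z
      simp [dec0 (show 0 % 8 = 0 from rfl), HLTL.encode]
    · intro a c
      rcases mod8 c with h | h | h | h | h | h | h | h
      · simp [h, dec0 h, HLTL.encode]
      · simp [h, dec1 h, HLTL.encode]; omega
      · simp [h, dec2 h, HLTL.encode]
      · simp [h, dec3 h, HLTL.encode]
      · simp [h, dec4 h, HLTL.encode]
      · simp [h, dec5 h, HLTL.encode]
      · simp [h, dec6 h, HLTL.encode]
      · simp [h, dec7 h, HLTL.encode]
  exact h.comp (Primrec.const ()) Primrec.id

theorem pr_qf : Primrec fun c => (dec c).quantFree := by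
  have h : Primrec₂ fun (_ : Unit) c => (dec c).quantFree := by
    refine pr_rec _ (fun _ c x y z =>
      if c % 8 = 0 then true else if c % 8 = 1 then true else if c % 8 = 2 then x
      else if c % 8 = 3 then (y && z) else if c % 8 = 4 then x
      else if c % 8 = 5 then (y && z) else false) ?_ ?_ ?_
    · have hc : Primrec fun x : (Unit × ℕ) × Bool × Bool × Bool => x.1.2 :=
        Primrec.snd.comp Primrec.fst
      have hx : Primrec fun x : (Unit × ℕ) × Bool × Bool × Bool => x.2.1 :=
        Primrec.fst.comp Primrec.snd
      have hy : Primrec fun x : (Unit × ℕ) × Bool × Bool × Bool => x.2.2.1 :=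
        Primrec.fst.comp (Primrec.snd.comp Primrec.snd)
      have hz : Primrec fun x : (Unit × ℕ) × Bool × Bool × Bool => x.2.2.2 :=
        Primrec.snd.comp (Primrec.snd.comp Primrec.snd)
      have hyz := Primrec.and.comp hy hz
      exact Primrec.ite (pr_md hc 0) (Primrec.const true) <|
        Primrec.ite (pr_md hc 1) (Primrec.const true) <|
        Primrec.ite (pr_md hc 2) hx <| Primrec.ite (pr_md hc 3) hyz <|
        Primrec.ite (pr_md hc 4) hx <| Primrec.ite (pr_md hc 5) hyz (Primrec.const false)
    · intro a x y z
      simp [dec0 (show 0 % 8 = 0 from rfl), HLTL.quantFree]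
    · intro a c
      rcases mod8 c with h | h | h | h | h | h | h | h
      · simp [h, dec0 h, HLTL.quantFree]
      · simp [h, dec1 h, HLTL.quantFree]
      · simp [h, dec2 h, HLTL.quantFree]
      · simp [h, dec3 h, HLTL.quantFree]
      · simp [h, dec4 h, HLTL.quantFree]
      · simp [h, dec5 h, HLTL.quantFree]
      · simp [h, dec6 h, HLTL.quantFree]
      · simp [h, dec7 h, HLTL.quantFree]
  exact h.comp (Primrec.const ()) Primrec.id

theorem pr_prenex : Primrec fun c => (dec c).prenex := by
  have h : Primrec₂ fun (_ : Unit) c => (dec c).prenex := by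
    refine pr_rec _ (fun _ c _ _ z =>
      if c % 8 = 6 then z else if c % 8 = 7 then z else (dec c).quantFree) ?_ ?_ ?_
    · have hc : Primrec fun x : (Unit × ℕ) × Bool × Bool × Bool => x.1.2 :=
        Primrec.snd.comp Primrec.fst
      have hz : Primrec fun x : (Unit × ℕ) × Bool × Bool × Bool => x.2.2.2 :=
        Primrec.snd.comp (Primrec.snd.comp Primrec.snd)
      exact Primrec.ite (pr_md hc 6) hz <| Primrec.ite (pr_md hc 7) hz (pr_qf.comp hc)
    · intro a x y z
      simp [dec0 (show 0 % 8 = 0 from rfl), HLTL.prenex]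
    · intro a c
      rcases mod8 c with h | h | h | h | h | h | h | h
      · simp [h, dec0 h, HLTL.prenex]
      · simp [h, dec1 h, HLTL.prenex]
      · simp [h, dec2 h, HLTL.prenex]
      · simp [h, dec3 h, HLTL.prenex]
      · simp [h, dec4 h, HLTL.prenex]
      · simp [h, dec5 h, HLTL.prenex]
      · simp [h, dec6 h, HLTL.prenex]
      · simp [h, dec7 h, HLTL.prenex]
  exact h.comp (Primrec.const ()) Primrec.id

theorem pr_free : Primrec₂ fun (π c : ℕ) => decide (π ∈ (dec c).free) := by
  refine pr_rec _ (fun π c x y z =>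
    if c % 8 = 0 then false else if c % 8 = 1 then decide (π = (c / 8).unpair.2)
    else if c % 8 = 2 then x else if c % 8 = 3 then (y || z) else if c % 8 = 4 then x
    else if c % 8 = 5 then (y || z) else if π = (c / 8).unpair.1 then false else z) ?_ ?_ ?_
  · have hp : Primrec fun x : (ℕ × ℕ) × Bool × Bool × Bool => x.1.1 :=
      Primrec.fst.comp Primrec.fst
    have hc : Primrec fun x : (ℕ × ℕ) × Bool × Bool × Bool => x.1.2 :=
      Primrec.snd.comp Primrec.fst
    have hx : Primrec fun x : (ℕ × ℕ) × Bool × Bool × Bool => x.2.1 :=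
      Primrec.fst.comp Primrec.snd
    have hy : Primrec fun x : (ℕ × ℕ) × Bool × Bool × Bool => x.2.2.1 :=
      Primrec.fst.comp (Primrec.snd.comp Primrec.snd)
    have hz : Primrec fun x : (ℕ × ℕ) × Bool × Bool × Bool => x.2.2.2 :=
      Primrec.snd.comp (Primrec.snd.comp Primrec.snd)
    have hyz := Primrec.or.comp hy hz
    exact Primrec.ite (pr_md hc 0) (Primrec.const false) <|
      Primrec.ite (pr_md hc 1) (PrimrecPred.decide (Primrec.eq.comp hp (pr_u2 hc))) <|
      Primrec.ite (pr_md hc 2) hx <| Primrec.ite (pr_md hc 3) hyz <|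
      Primrec.ite (pr_md hc 4) hx <| Primrec.ite (pr_md hc 5) hyz <|
      Primrec.ite (Primrec.eq.comp hp (pr_u1 hc)) (Primrec.const false) hz
  · intro a x y z
    simp [dec0 (show 0 % 8 = 0 from rfl), HLTL.free]
  · intro π c
    rcases mod8 c with h | h | h | h | h | h | h | h
    · simp [h, dec0 h, HLTL.free]
    · simp [h, dec1 h, HLTL.free]
    · simp [h, dec2 h, HLTL.free]
    · simp [h, dec3 h, HLTL.free]
    · simp [h, dec4 h, HLTL.free]
    · simp [h, dec5 h, HLTL.free]
    · by_cases hπ : π = (c / 8).unpair.1 <;> simp [h, dec6 h, HLTL.free, hπ]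
    · by_cases hπ : π = (c / 8).unpair.1 <;> simp [h, dec7 h, HLTL.free, hπ]

theorem pr_main (m : ℕ) : PrimrecPred fun n : ℕ =>
    ((dec n).encode = n ∧ (dec n).prenex = true ∧ (∀ π < n + 1, ¬ π ∈ (dec n).free) ∧
      ∃ N < bnd m n + 1, ∃ p < N, ∃ W < tbl m n, Cert m n N p (Bit W)) := by
  have hfree : PrimrecPred fun x : ℕ × ℕ => x.2 ∈ (dec x.1).free :=
    Primrec.primrecPred (pr_free.comp Primrec.snd Primrec.fst)
  refine (Primrec.eq.comp pr_enc Primrec.id).and <|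
    (Primrec.eq.comp pr_prenex (Primrec.const true)).and <|
    (pr_all (pr_add Primrec.id (Primrec.const 1)) hfree.not).and <|
    pr_ex (pr_add (pr_bnd m) (Primrec.const 1)) <| pr_ex Primrec.snd <|
    pr_ex ((pr_tbl m).comp (Primrec.fst.comp Primrec.fst)) ?_
  exact pr_cert m (Primrec.fst.comp (Primrec.fst.comp Primrec.fst))
    (Primrec.snd.comp (Primrec.fst.comp Primrec.fst)) (Primrec.snd.comp Primrec.fst) Primrec.snd

end HB

/-- For every fixed `m ≥ 1`, bounded HyperLTL satisfiability is decidable: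
the predicate "the HyperLTL formula with Gödel code `n` is satisfiable by
some nonempty trace set of cardinality at most `m`" is computable. -/
theorem hyperLTLSat_bounded_decidable (m : ℕ) (hm : 1 ≤ m) :
    ComputablePred (fun n : ℕ =>
      ∃ ψ : HLTL, HLTL.Sentence ψ ∧ HLTL.encode ψ = n ∧
        ∃ T : Set Trace, T.Finite ∧ T.ncard ≤ m ∧ HLTL.SatBy T ψ) := by
  obtain ⟨inst, h⟩ := (HB.pr_main m).of_eq fun n => (HB.main_iff hm n).symm
  exact ⟨inst, h.to_comp⟩
end
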